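/- arXiv:2401.09224 — 2 statements merged into one kernel-verified Lean document; each statement's English description precedes it below -/
import Mathlib

section
/- Let p be a prime and X a subgroup of the symmetric group S_m whose order is coprime to p. If m > 1, then |X| < p^{m-1}. -/
open Equiv

def FF (p n : ℕ) : ℕ := if n ≤ 1 then 1 else 2 * p ^ (n - 2)

def Bd (p n : ℕ) : Prop := ∀ (β : Type) [Fintype β] (K : Subgroup (Perm β)),
  Fintype.card β = n → Nat.Coprime (Nat.card K) p → Nat.card K ≤ FF p n


theorem FF_pos {p : ℕ} (hp : 2 ≤ p) (n : ℕ) : 0 < FF p n := by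
  unfold FF; split_ifs <;> positivity

theorem FF_mul {p : ℕ} (hp : 2 ≤ p) {n : ℕ} (hn : 1 ≤ n) : FF p n * p ≤ p ^ n := by
  unfold FF
  split_ifs with h
  · have : n = 1 := by omega
    subst this; simp
  · obtain ⟨k, rfl⟩ : ∃ k, n = k + 2 := ⟨n - 2, by omega⟩
    simp only [Nat.add_sub_cancel]
    have : p ^ (k+2) = p * p ^ k * p := by ring
    rw [this]
    gcongr

theorem FF_le {p : ℕ} (hp : 2 ≤ p) {n : ℕ} (hn : 1 ≤ n) : FF p n ≤ p ^ (n - 1) := by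
  have h := FF_mul hp hn
  obtain ⟨k, rfl⟩ : ∃ k, n = k + 1 := ⟨n - 1, by omega⟩
  rw [pow_succ] at h
  exact Nat.le_of_mul_le_mul_right h (by omega)

theorem FF_two {p n : ℕ} (hn : 2 ≤ n) : FF p n = 2 * p ^ (n - 2) := by
  unfold FF; rw [if_neg (by omega)]

theorem L0 {p : ℕ} {α : Type} {H K : Subgroup (Perm α)} [Finite α] {β : Type} [Fintype β]
    (φ : H →* Perm β) (hH : Nat.Coprime (Nat.card H) p) (hB : Bd p (Fintype.card β))
    (hK : ∀ g : H, φ g = 1 → (g : Perm α) ∈ K) :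
    Nat.card H ≤ FF p (Fintype.card β) * Nat.card K := by
  have h1 : Nat.card φ.ker * φ.ker.index = Nat.card H := Subgroup.card_mul_index _
  have h2 : φ.ker.index = Nat.card φ.range := Subgroup.index_ker φ
  have h3 : Nat.card φ.range ≤ FF p (Fintype.card β) := by
    apply hB _ _ rfl
    apply Nat.Coprime.coprime_dvd_left _ hH
    rw [← h1, h2]; exact Dvd.intro_left _ rfl
  have h4 : Nat.card φ.ker ≤ Nat.card K := by
    refine Nat.card_le_card_of_injective (fun g => (⟨g.1.1, hK g.1 g.2⟩ : K)) ?_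
    intro a b hab
    simp only [Subtype.mk.injEq] at hab
    exact Subtype.ext (Subtype.ext hab)
  rw [← h1, h2, mul_comm]
  exact Nat.mul_le_mul h3 h4

/-- elements of H fixing R pointwise -/
def Fx {α : Type} (H : Subgroup (Perm α)) (R : Finset α) : Subgroup (Perm α) where
  carrier := {g | g ∈ H ∧ ∀ a ∈ R, g a = a}
  mul_mem' := by
    rintro a b ⟨ha, ha'⟩ ⟨hb, hb'⟩
    refine ⟨H.mul_mem ha hb, fun x hx => ?_⟩
    rw [Perm.mul_apply, hb' x hx, ha' x hx]
  one_mem' := ⟨H.one_mem, fun _ _ => rfl⟩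
  inv_mem' := by
    rintro a ⟨ha, ha'⟩
    refine ⟨H.inv_mem ha, fun x hx => ?_⟩
    rw [Perm.inv_eq_iff_eq, ha' x hx]

theorem mem_Fx {α : Type} {H : Subgroup (Perm α)} {R : Finset α} {g : Perm α} :
    g ∈ Fx H R ↔ g ∈ H ∧ ∀ a ∈ R, g a = a := Iff.rfl

theorem Fx_le {α : Type} (H : Subgroup (Perm α)) (R : Finset α) : Fx H R ≤ H := fun _ h => h.1

theorem coprime_of_le {p : ℕ} {α : Type} {H K : Subgroup (Perm α)} (h : H ≤ K)
    (hK : Nat.Coprime (Nat.card K) p) : Nat.Coprime (Nat.card H) p :=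
  Nat.Coprime.coprime_dvd_left (Subgroup.card_dvd_of_le h) hK

def Inva {α : Type} (H : Subgroup (Perm α)) (R : Finset α) : Prop := ∀ g ∈ H, ∀ a ∈ R, g a ∈ R

theorem L1 {p : ℕ} {α : Type} [Finite α] {H : Subgroup (Perm α)} (R : Finset α)
    (hR : Inva H R) (hH : Nat.Coprime (Nat.card H) p) (hB : Bd p R.card) :
    Nat.card H ≤ FF p R.card * Nat.card (Fx H R) := by
  have hi : ∀ g : H, ∀ x, (g : Perm α) x ∈ R ↔ x ∈ R := by
    intro g x
    refine ⟨fun h => ?_, hR g g.2 x⟩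
    have := hR _ (H.inv_mem g.2) _ h
    simpa using this
  let φ : H →* Perm R :=
    { toFun := fun g => (g : Perm α).subtypePerm (hi g)
      map_one' := by ext; simp
      map_mul' := by intro a b; ext; rfl }
  have := L0 (p := p) (K := Fx H R) φ hH (by simpa using hB) (by
    intro g hg
    refine ⟨g.2, fun a ha => ?_⟩
    have := congrArg (fun e : Perm R => ((e ⟨a, ha⟩ : R) : α)) hg
    simpa [φ] using this)
  simpa using this

theorem Peel {p : ℕ} {α ι : Type} [Finite α] [DecidableEq α] {H : Subgroup (Perm α)} (J : Finset ι)
    (R : ι → Finset α) (hR : ∀ i ∈ J, Inva H (R i)) (hH : Nat.Coprime (Nat.card H) p)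
    (hB : ∀ i ∈ J, Bd p (R i).card) :
    Nat.card H ≤ (∏ i ∈ J, FF p (R i).card) * Nat.card (Fx H (J.biUnion R)) := by
  classical
  induction J using Finset.induction_on with
  | empty =>
    simp only [Finset.prod_empty, one_mul, Finset.biUnion_empty]
    apply Nat.card_le_card_of_injective (fun g : H => (⟨g.1, g.2, by simp⟩ : Fx H ∅))
    intro a b hab
    have := congrArg Subtype.val hab
    exact Subtype.ext this
  | insert i J hi ih =>
    have ih := ih (fun j hj => hR j (Finset.mem_insert_of_mem hj))
      (fun j hj => hB j (Finset.mem_insert_of_mem hj))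
    rw [Finset.prod_insert hi, Finset.biUnion_insert]
    have h1 := L1 (p := p) (H := Fx H (J.biUnion R)) (R i)
      (fun g hg => hR i (Finset.mem_insert_self _ _) g hg.1)
      (coprime_of_le (Fx_le _ _) hH) (hB i (Finset.mem_insert_self _ _))
    have h2 : Fx (Fx H (J.biUnion R)) (R i) = Fx H (R i ∪ J.biUnion R) := by
      ext g
      simp only [mem_Fx, Finset.mem_union]
      constructor
      · rintro ⟨⟨a, b⟩, c⟩
        exact ⟨a, fun x hx => hx.elim (c x) (b x)⟩
      · rintro ⟨a, b⟩
        exact ⟨⟨a, fun x hx => b x (Or.inr hx)⟩, fun x hx => b x (Or.inl hx)⟩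
    rw [h2] at h1
    calc _ ≤ _ := ih
      _ ≤ _ := Nat.mul_le_mul_left _ h1
      _ = _ := by ring

section GSsec
variable {α : Type} [Fintype α] [DecidableEq α]

def GS (X : Subgroup (Perm α)) (S : Finset α) : Subgroup (Perm α) := Fx X Sᶜ

theorem mem_GS {X : Subgroup (Perm α)} {S : Finset α} {g : Perm α} :
    g ∈ GS X S ↔ g ∈ X ∧ ∀ a ∉ S, g a = a := by simp [GS, mem_Fx]

theorem GS_univ (X : Subgroup (Perm α)) : GS X Finset.univ = X := by
  ext g; simp [mem_GS]

theorem GS_le (X : Subgroup (Perm α)) (S : Finset α) : GS X S ≤ X := Fx_le _ _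

theorem GS_inv (X : Subgroup (Perm α)) (S : Finset α) : Inva (GS X S) S := by
  intro g hg a ha
  by_contra h
  have := (mem_GS.1 hg).2 _ h
  rw [g.injective this] at h
  exact h ha

theorem GS_mono (X : Subgroup (Perm α)) {S S' : Finset α} (h : S ⊆ S') : GS X S ≤ GS X S' := by
  intro g hg
  rw [mem_GS] at *
  exact ⟨hg.1, fun a ha => hg.2 a (fun h' => ha (h h'))⟩

theorem Fx_GS (X : Subgroup (Perm α)) (S R : Finset α) : Fx (GS X S) R = GS X (S \ R) := by
  ext g
  simp only [mem_Fx, mem_GS, Finset.mem_sdiff, not_and, not_not]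
  constructor
  · rintro ⟨⟨a, b⟩, c⟩
    refine ⟨a, fun x hx => ?_⟩
    by_cases h : x ∈ S
    · exact c x (hx h)
    · exact b x h
  · rintro ⟨a, b⟩
    exact ⟨⟨a, fun x hx => b x (fun h => absurd h hx)⟩, fun x hx => b x (fun _ => hx)⟩

theorem Inva_mono {H K : Subgroup (Perm α)} (h : H ≤ K) {R : Finset α} (hR : Inva K R) : Inva H R :=
  fun g hg => hR g (h hg)

theorem Inva_sdiff {H : Subgroup (Perm α)} {S R : Finset α} (hS : Inva H S) (hR : Inva H R) :
    Inva H (S \ R) := by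
  intro g hg a ha
  rw [Finset.mem_sdiff] at *
  refine ⟨hS g hg a ha.1, fun h => ha.2 ?_⟩
  simpa using hR _ (H.inv_mem hg) _ h

theorem Inva_union {H : Subgroup (Perm α)} {S R : Finset α} (hS : Inva H S) (hR : Inva H R) :
    Inva H (S ∪ R) := by
  intro g hg a ha
  rw [Finset.mem_union] at *
  exact ha.imp (hS g hg a) (hR g hg a)

theorem L1S {p : ℕ} {X : Subgroup (Perm α)} {S R : Finset α} (hR : Inva (GS X S) R)
    (hX : Nat.Coprime (Nat.card X) p) (hB : Bd p R.card) :
    Nat.card (GS X S) ≤ FF p R.card * Nat.card (GS X (S \ R)) := by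
  have := L1 R hR (coprime_of_le (GS_le _ _) hX) hB
  rwa [Fx_GS] at this

open Classical in
noncomputable def orb (H : Subgroup (Perm α)) (a : α) : Finset α := Finset.univ.filter (fun b => ∃ g ∈ H, g a = b)

theorem mem_orb {H : Subgroup (Perm α)} {a b : α} : b ∈ orb H a ↔ ∃ g ∈ H, g a = b := by
  simp [orb]

theorem self_mem_orb (H : Subgroup (Perm α)) (a : α) : a ∈ orb H a :=
  mem_orb.2 ⟨1, H.one_mem, rfl⟩

theorem orb_inv (H : Subgroup (Perm α)) (a : α) : Inva H (orb H a) := by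
  intro g hg b hb
  obtain ⟨h, hh, rfl⟩ := mem_orb.1 hb
  exact mem_orb.2 ⟨g * h, H.mul_mem hg hh, rfl⟩

theorem orb_eq {H : Subgroup (Perm α)} {a b : α} (h : b ∈ orb H a) : orb H b = orb H a := by
  obtain ⟨g, hg, rfl⟩ := mem_orb.1 h
  ext c
  rw [mem_orb, mem_orb]
  constructor
  · rintro ⟨k, hk, rfl⟩; exact ⟨k * g, H.mul_mem hk hg, rfl⟩
  · rintro ⟨k, hk, rfl⟩; exact ⟨k * g⁻¹, H.mul_mem hk (H.inv_mem hg), by simp⟩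

theorem orb_sub {H : Subgroup (Perm α)} {R : Finset α} (hR : Inva H R) {a : α} (ha : a ∈ R) :
    orb H a ⊆ R := by
  intro b hb
  obtain ⟨g, hg, rfl⟩ := mem_orb.1 hb
  exact hR g hg a ha

theorem biUnion_orb {H : Subgroup (Perm α)} {R : Finset α} (hR : Inva H R) :
    (R.image (orb H)).biUnion id = R := by
  ext a
  simp only [Finset.mem_biUnion, Finset.mem_image, id]
  constructor
  · rintro ⟨_, ⟨b, hb, rfl⟩, h⟩; exact orb_sub hR hb h
  · intro h; exact ⟨_, ⟨a, h, rfl⟩, self_mem_orb _ _⟩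

theorem orb_disj {H : Subgroup (Perm α)} {a b : α} (h : orb H a ≠ orb H b) :
    Disjoint (orb H a) (orb H b) := by
  rw [Finset.disjoint_left]
  intro c hc hc'
  exact h ((orb_eq hc).symm.trans (orb_eq hc'))

theorem sum_orb {H : Subgroup (Perm α)} {R : Finset α} (hR : Inva H R) :
    ∑ O ∈ R.image (orb H), O.card = R.card := by
  conv_rhs => rw [← biUnion_orb hR]
  rw [Finset.card_biUnion]
  · rfl
  · intro x hx y hy hxy
    obtain ⟨a, -, rfl⟩ := Finset.mem_image.1 hx
    obtain ⟨b, -, rfl⟩ := Finset.mem_image.1 hy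
    exact orb_disj hxy

/-- ML -/
theorem ML {p : ℕ} (hp : 2 ≤ p) {X : Subgroup (Perm α)} {S R : Finset α} (hR : Inva (GS X S) R)
    (hX : Nat.Coprime (Nat.card X) p) (hB : ∀ k ≤ R.card, Bd p k) :
    Nat.card (GS X S) * p ^ (R.image (orb (GS X S))).card ≤
      p ^ R.card * Nat.card (GS X (S \ R)) := by
  have h := Peel (p := p) (H := GS X S) (R.image (orb (GS X S))) id
    (by intro i hi; obtain ⟨a, ha, rfl⟩ := Finset.mem_image.1 hi; exact orb_inv _ _)
    (coprime_of_le (GS_le _ _) hX)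
    (by
      intro i hi; obtain ⟨a, ha, rfl⟩ := Finset.mem_image.1 hi
      exact hB _ (Finset.card_le_card (orb_sub hR ha)))
  rw [biUnion_orb hR, Fx_GS] at h
  have h2 : (∏ O ∈ R.image (orb (GS X S)), FF p O.card) * p ^ (R.image (orb (GS X S))).card
      ≤ p ^ R.card := by
    conv_rhs => rw [← sum_orb hR]
    rw [← Finset.prod_pow_eq_pow_sum, ← Finset.prod_const, ← Finset.prod_mul_distrib]
    apply Finset.prod_le_prod' 
    intro i hi
    obtain ⟨a, ha, rfl⟩ := Finset.mem_image.1 hi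
    exact FF_mul hp (Finset.card_pos.2 ⟨a, self_mem_orb _ _⟩)
  calc _ ≤ _ := Nat.mul_le_mul_right _ h
    _ = _ := by simp only [id]; ring
    _ ≤ _ := Nat.mul_le_mul_right _ h2

end GSsec

open Equiv
section Blk
variable {α : Type} [Fintype α] [DecidableEq α]
open scoped Pointwise

def TransOn (H : Subgroup (Perm α)) (S : Finset α) : Prop := ∀ a ∈ S, ∀ b ∈ S, ∃ g ∈ H, g a = b

def Blk (H : Subgroup (Perm α)) (B : Finset α) : Prop := ∀ g ∈ H, g • B = B ∨ Disjoint (g • B) B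

theorem BlkA {p : ℕ} {X : Subgroup (Perm α)} {S B : Finset α} (hBS : B ⊆ S) (hne : B.Nonempty)
    (htr : TransOn (GS X S) S) (hblk : Blk (GS X S) B) (hX : Nat.Coprime (Nat.card X) p)
    (hB : Bd p B.card) :
    ∃ c, c * B.card = S.card ∧ (Bd p c → ∀ j ≤ c, ∃ U ⊆ S, U.card = (c - j) * B.card ∧
      Nat.card (GS X S) ≤ FF p c * FF p B.card ^ j * Nat.card (GS X U)) := by
  classical
  set H := GS X S with hH
  let Q : Finset (Finset α) := Finset.univ.filter (fun D => ∃ g ∈ H, g • B = D)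
  have hQ : ∀ D, D ∈ Q ↔ ∃ g ∈ H, g • B = D := by intro D; simp [Q]
  have hQcard : ∀ D ∈ Q, D.card = B.card := by
    intro D hD
    obtain ⟨g, _, rfl⟩ := (hQ D).1 hD
    exact Finset.card_smul_finset _ _
  have hdisj : ∀ D ∈ Q, ∀ E ∈ Q, D ≠ E → Disjoint D E := by
    intro D hD E hE hne
    obtain ⟨g, hg, rfl⟩ := (hQ D).1 hD
    obtain ⟨h, hh, rfl⟩ := (hQ E).1 hE
    have := hblk (h⁻¹ * g) (H.mul_mem (H.inv_mem hh) hg)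
    rcases this with h1 | h1
    · exfalso; apply hne
      rw [mul_smul, inv_smul_eq_iff] at h1
      exact h1
    · rw [Finset.disjoint_left] at h1 ⊢
      intro x hx hx'
      have := @h1 (h⁻¹ • x)
      rw [mul_smul, Finset.smul_mem_smul_finset_iff] at this
      obtain ⟨y, hy, rfl⟩ := Finset.mem_smul_finset.1 hx'
      exact this hx (by simpa using hy)
  have hcov : Q.biUnion id = S := by
    ext x
    simp only [Finset.mem_biUnion, id]
    constructor
    · rintro ⟨D, hD, hx⟩
      obtain ⟨g, hg, rfl⟩ := (hQ D).1 hD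
      obtain ⟨y, hy, rfl⟩ := Finset.mem_smul_finset.1 hx
      exact GS_inv X S g hg y (hBS hy)
    · intro hx
      obtain ⟨b, hb⟩ := hne
      obtain ⟨g, hg, rfl⟩ := htr b (hBS hb) x hx
      exact ⟨g • B, (hQ _).2 ⟨g, hg, rfl⟩, Finset.mem_smul_finset.2 ⟨b, hb, rfl⟩⟩
  have hun : ∀ J ⊆ Q, (J.biUnion id).card = J.card * B.card := by
    intro J hJ
    rw [Finset.card_biUnion]
    · rw [Finset.sum_const_nat (m := B.card)]
      intro x hx; exact hQcard x (hJ hx)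
    · intro x hx y hy hxy; exact hdisj x (hJ hx) y (hJ hy) hxy
  refine ⟨Q.card, ?_, ?_⟩
  · rw [← hun Q (Finset.Subset.refl _), hcov]
  intro hBc j hj
  obtain ⟨J, hJ, hJc⟩ := Finset.exists_subset_card_eq hj
  refine ⟨S \ J.biUnion id, Finset.sdiff_subset, ?_, ?_⟩
  · rw [Finset.card_sdiff_of_subset, hun J hJ, hJc, ← hcov, hun Q (Finset.Subset.refl _),
      Nat.sub_mul]
    rw [← hcov]; exact Finset.biUnion_subset_biUnion_of_subset_left _ hJ
  -- kernel
  let K0 : Subgroup (Perm α) :=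
    { carrier := {g | g ∈ H ∧ ∀ D ∈ Q, g • D = D}
      mul_mem' := by
        rintro a b ⟨ha, ha'⟩ ⟨hb, hb'⟩
        refine ⟨H.mul_mem ha hb, fun D hD => ?_⟩
        rw [mul_smul, hb' D hD, ha' D hD]
      one_mem' := ⟨H.one_mem, fun D _ => one_smul _ D⟩
      inv_mem' := by
        rintro a ⟨ha, ha'⟩
        refine ⟨H.inv_mem ha, fun D hD => ?_⟩
        rw [inv_smul_eq_iff, ha' D hD] }
  have hK0 : K0 ≤ H := fun g hg => hg.1
  have hQi : ∀ g ∈ H, ∀ D ∈ Q, g • D ∈ Q := by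
    intro g hg D hD
    obtain ⟨h, hh, rfl⟩ := (hQ D).1 hD
    exact (hQ _).2 ⟨g * h, H.mul_mem hg hh, mul_smul _ _ _⟩
  have hQi' : ∀ g : H, ∀ D, MulAction.toPerm (g : Perm α) D ∈ Q ↔ D ∈ Q := by
    intro g D
    refine ⟨fun h => ?_, hQi g g.2 D⟩
    have := hQi _ (H.inv_mem g.2) _ h
    simpa using this
  let φ : H →* Perm Q :=
    { toFun := fun g => (MulAction.toPerm (g : Perm α) : Perm (Finset α)).subtypePerm (hQi' g)
      map_one' := by ext1 D; apply Subtype.ext; exact one_smul (Perm α) (D : Finset α)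
      map_mul' := by
        intro a b; ext1 D; apply Subtype.ext; exact mul_smul (a : Perm α) (b : Perm α) (D : Finset α) }
  have hHc : Nat.Coprime (Nat.card H) p := coprime_of_le (GS_le _ _) hX
  have h1 := L0 (p := p) (K := K0) φ hHc (by simpa using hBc) (by
    intro g hg
    refine ⟨g.2, fun D hD => ?_⟩
    exact congrArg (fun e : Perm Q => ((e ⟨D, hD⟩ : Q) : Finset α)) hg)
  have h2 := Peel (p := p) (H := K0) J id (by
      intro D hD g hg a ha
      have := hg.2 D (hJ hD)
      simp only [id] at *
      rw [← this]
      exact Finset.mem_smul_finset.2 ⟨a, ha, rfl⟩) (coprime_of_le hK0 hHc) (by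
      intro D hD; simp only [id]; rw [hQcard D (hJ hD)]; exact hB)
  have h3 : ∏ i ∈ J, FF p (id i).card = FF p B.card ^ j := by
    rw [← hJc]
    apply Finset.prod_eq_pow_card
    intro D hD; simp only [id]; rw [hQcard D (hJ hD)]
  rw [h3] at h2
  have h4 : Fx K0 (J.biUnion id) ≤ GS X (S \ J.biUnion id) := by
    rw [← Fx_GS]
    intro g hg
    exact ⟨hK0 hg.1, hg.2⟩
  have h5 := Subgroup.card_le_of_le h4
  have h6 : Fintype.card Q = Q.card := Fintype.card_coe Q
  rw [h6] at h1
  calc _ ≤ _ := h1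
    _ ≤ _ := Nat.mul_le_mul_left _ (h2.trans (Nat.mul_le_mul_left _ h5))
    _ = _ := by ring
end Blk

open Equiv
section Link
variable {α : Type} [Fintype α] [DecidableEq α]
open scoped Pointwise
open MulAction

theorem GS_empty (X : Subgroup (Perm α)) : Nat.card (GS X ∅) = 1 := by
  have : GS X ∅ = ⊥ := by
    rw [eq_bot_iff]
    intro g hg
    rw [Subgroup.mem_bot]
    ext a
    simpa using (mem_GS.1 hg).2 a (by simp)
  rw [this]; simp

def lift_GS {X : Subgroup (Perm α)} {S : Finset α} {g : Perm α} (hg : g ∈ GS X S) :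
    fixingSubgroup X ((S : Set α)ᶜ) :=
  ⟨⟨g, hg.1⟩, by
    rw [mem_fixingSubgroup_iff]
    intro y hy
    exact (mem_GS.1 hg).2 y (by simpa using hy)⟩

theorem unlift_GS {X : Subgroup (Perm α)} {S : Finset α} (g : fixingSubgroup X ((S : Set α)ᶜ)) :
    ((g : X) : Perm α) ∈ GS X S := by
  rw [mem_GS]
  refine ⟨g.1.2, fun a ha => ?_⟩
  have := (mem_fixingSubgroup_iff _).1 g.2 a (by simpa using ha)
  exact this

theorem mem_ofFix {X : Subgroup (Perm α)} {S : Finset α} {a : α} :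
    a ∈ SubMulAction.ofFixingSubgroup X ((S : Set α)ᶜ) ↔ a ∈ S := by
  rw [SubMulAction.mem_ofFixingSubgroup_iff]; simp

theorem link_trans {X : Subgroup (Perm α)} {S : Finset α} (h : TransOn (GS X S) S) :
    IsPretransitive (fixingSubgroup X ((S : Set α)ᶜ))
      (SubMulAction.ofFixingSubgroup X ((S : Set α)ᶜ)) := by
  constructor
  intro x y
  obtain ⟨g, hg, hgx⟩ := h x (mem_ofFix.1 x.2) y (mem_ofFix.1 y.2)
  refine ⟨lift_GS hg, ?_⟩
  apply Subtype.ext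
  exact hgx

theorem link_prim {X : Subgroup (Perm α)} {S : Finset α} (h : TransOn (GS X S) S)
    (hb : ∀ B ⊆ S, Blk (GS X S) B → B.card ≤ 1 ∨ B = S) :
    IsPreprimitive (fixingSubgroup X ((S : Set α)ᶜ))
      (SubMulAction.ofFixingSubgroup X ((S : Set α)ᶜ)) := by
  classical
  have := link_trans h
  refine { isTrivialBlock_of_isBlock := ?_ }
  intro C hC
  rw [isBlock_iff_smul_eq_or_disjoint] at hC
  let B : Finset α := (C.toFinset).image Subtype.val
  have hBm : ∀ a, a ∈ B ↔ ∃ x ∈ C, (x : α) = a := by intro a; simp [B]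
  have hBS : B ⊆ S := by
    intro a ha
    obtain ⟨x, hx, rfl⟩ := (hBm _).1 ha
    exact mem_ofFix.1 x.2
  have hBB : Blk (GS X S) B := by
    intro g hg
    rcases hC (lift_GS hg) with h2 | h2
    · left
      apply Finset.eq_of_subset_of_card_le
      · intro a ha
        obtain ⟨b, hb, rfl⟩ := Finset.mem_smul_finset.1 ha
        obtain ⟨x, hx, rfl⟩ := (hBm _).1 hb
        have : lift_GS hg • x ∈ C := by rw [← h2]; exact Set.smul_mem_smul_set hx
        exact (hBm _).2 ⟨_, this, rfl⟩
      · rw [Finset.card_smul_finset]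
    · right
      rw [Finset.disjoint_left]
      intro a ha ha'
      obtain ⟨b, hb, rfl⟩ := Finset.mem_smul_finset.1 ha
      obtain ⟨x, hx, rfl⟩ := (hBm _).1 hb
      obtain ⟨y, hy, hyx⟩ := (hBm _).1 ha'
      have h3 : lift_GS hg • x = y := Subtype.ext hyx.symm
      exact Set.disjoint_left.1 h2 (Set.smul_mem_smul_set hx) (h3 ▸ hy)
  rcases hb B hBS hBB with h1 | h1
  · left
    intro x hx y hy
    apply Subtype.ext
    exact Finset.card_le_one.1 h1 _ ((hBm _).2 ⟨x, hx, rfl⟩) _ ((hBm _).2 ⟨y, hy, rfl⟩)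
  · right
    ext x
    simp only [Set.mem_univ, iff_true]
    have : (x : α) ∈ B := by rw [h1]; exact mem_ofFix.1 x.2
    obtain ⟨y, hy, hyx⟩ := (hBm _).1 this
    rwa [← Subtype.ext hyx]

theorem link_prim_top {X : Subgroup (Perm α)} (h : TransOn X Finset.univ)
    (hb : ∀ B : Finset α, Blk X B → B.card ≤ 1 ∨ B = Finset.univ) : IsPreprimitive X α := by
  classical
  have : IsPretransitive X α := by
    constructor
    intro x y
    obtain ⟨g, hg, hgx⟩ := h x (Finset.mem_univ _) y (Finset.mem_univ _)
    exact ⟨⟨g, hg⟩, hgx⟩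
  refine { isTrivialBlock_of_isBlock := ?_ }
  intro C hC
  rw [isBlock_iff_smul_eq_or_disjoint] at hC
  have hBB : Blk X C.toFinset := by
    intro g hg
    rcases hC ⟨g, hg⟩ with h2 | h2
    · left
      have : g • C = C := h2
      ext a
      rw [← Finset.mem_coe, Finset.coe_smul_finset]
      simp [this]
    · right
      have : Disjoint (g • C) C := h2
      rw [← Finset.disjoint_coe, Finset.coe_smul_finset]
      simpa using this
  rcases hb C.toFinset hBB with h1 | h1
  · left
    intro x hx y hy
    exact Finset.card_le_one.1 h1 _ (by simpa using hx) _ (by simpa using hy)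
  · right
    ext x
    have := Finset.mem_univ x
    rw [← h1] at this
    simpa using this

theorem FF_mul_FF {p a b : ℕ} (hp : 2 ≤ p) (ha : 1 ≤ a) (hb : 1 ≤ b) :
    FF p a * FF p b ≤ FF p (a + b) := by
  rw [FF_two (by omega : 2 ≤ a + b)]
  rcases eq_or_lt_of_le ha with h | h
  · subst h
    have : FF p 1 = 1 := by simp [FF]
    rw [this, one_mul]
    refine (FF_le hp hb).trans ?_
    have : 1 + b - 2 = b - 1 := by omega
    rw [this]; omega
  · rw [FF_two h]
    calc 2 * p ^ (a - 2) * FF p b ≤ 2 * p ^ (a - 2) * p ^ (b - 1) :=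
          Nat.mul_le_mul_left _ (FF_le hp hb)
      _ = 2 * p ^ (a - 2 + (b - 1)) := by rw [pow_add]; ring
      _ ≤ _ := by
        apply Nat.mul_le_mul_left
        exact Nat.pow_le_pow_right (by omega) (by omega)

theorem case_intrans {p : ℕ} (hp : 2 ≤ p) {X : Subgroup (Perm α)}
    (hX : Nat.Coprime (Nat.card X) p) (hB : ∀ k < Fintype.card α, Bd p k)
    (h : ¬ TransOn X Finset.univ) : Nat.card X ≤ FF p (Fintype.card α) := by
  unfold TransOn at h
  push Not at h
  obtain ⟨a, -, b, -, hab⟩ := h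
  set O := orb X a with hO
  have hbO : b ∉ O := by rw [mem_orb]; push Not; exact hab
  have hOc : O.card < Fintype.card α := Finset.card_lt_univ_of_notMem hbO
  have hO1 : 1 ≤ O.card := Finset.card_pos.2 ⟨a, self_mem_orb _ _⟩
  have hsum : (Finset.univ \ O).card = Fintype.card α - O.card := by
    rw [Finset.card_sdiff_of_subset (Finset.subset_univ _), Finset.card_univ]
  have h1 := L1S (p := p) (X := X) (S := Finset.univ) (R := O) (by rw [GS_univ]; exact orb_inv _ _)
    hX (hB _ hOc)
  have h2 := L1S (p := p) (X := X) (S := Finset.univ \ O) (R := Finset.univ \ O) (GS_inv _ _)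
    hX (hB _ (by omega))
  rw [sdiff_self, Finset.bot_eq_empty, GS_empty, mul_one, hsum] at h2
  rw [GS_univ] at h1
  calc _ ≤ _ := h1
    _ ≤ _ := Nat.mul_le_mul_left _ h2
    _ ≤ FF p (O.card + (Fintype.card α - O.card)) := FF_mul_FF hp hO1 (by omega)
    _ = _ := by congr 1; omega

theorem case_imprim {p : ℕ} (hp : 2 ≤ p) {X : Subgroup (Perm α)}
    (hX : Nat.Coprime (Nat.card X) p) (hB : ∀ k < Fintype.card α, Bd p k)
    (h : TransOn X Finset.univ) {B : Finset α} (hb : Blk X B) (h1 : 1 < B.card)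
    (h2 : B ≠ Finset.univ) : Nat.card X ≤ FF p (Fintype.card α) := by
  have hlt : B.card < Fintype.card α := by
    rw [Finset.card_lt_iff_ne_univ]; exact h2
  have hne : B.Nonempty := Finset.card_pos.1 (by omega)
  obtain ⟨c, hc, H⟩ := BlkA (p := p) (X := X) (S := Finset.univ) (B := B) (Finset.subset_univ _) hne
    (by rwa [GS_univ]) (by rwa [GS_univ]) hX (hB _ hlt)
  rw [Finset.card_univ] at hc
  have hc2 : 2 ≤ c := by
    by_contra hcon
    have : c ≤ 1 := by omega
    have := Nat.mul_le_mul_right B.card this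
    omega
  have hcm : c < Fintype.card α := by nlinarith
  obtain ⟨U, -, hU, hle⟩ := H (hB _ hcm) c le_rfl
  have hU0 : U = ∅ := by
    apply Finset.card_eq_zero.1; rw [hU]; simp
  rw [hU0, GS_empty, mul_one, GS_univ] at hle
  refine hle.trans ?_
  rw [FF_two hc2, FF_two (n := Fintype.card α) (by omega)]
  calc 2 * p ^ (c - 2) * FF p B.card ^ c ≤ 2 * p ^ (c-2) * (p ^ (B.card - 1)) ^ c := by
        apply Nat.mul_le_mul_left
        exact Nat.pow_le_pow_left (FF_le hp (by omega)) _
    _ = 2 * p ^ (c - 2 + (B.card - 1) * c) := by rw [← pow_mul, pow_add]; ring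
    _ = _ := by
      congr 2
      obtain ⟨b, hb⟩ : ∃ b, B.card = b + 1 := ⟨B.card - 1, by omega⟩
      rw [← hc, hb]
      simp only [Nat.add_sub_cancel]
      have : c * (b + 1) = b * c + c := by ring
      omega
end Link

open Equiv
section CaseThree
variable {α : Type} [Fintype α] [DecidableEq α]
open scoped Pointwise
open MulAction

theorem ncard_compl' (S : Finset α) : ((S : Set α)ᶜ).ncard = Fintype.card α - S.card := by
  rw [← Finset.coe_compl, Set.ncard_coe_finset, Finset.card_compl]

theorem card_mt {X : Subgroup (Perm α)} {t : ℕ} (ht : IsMultiplyPretransitive X α t) {S : Finset α}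
    (hS : Fintype.card α - S.card = t) :
    Nat.card X = (Fintype.card α).descFactorial t * Nat.card (GS X S) := by
  have h1 := ht.index_of_fixingSubgroup_mul (s := ((S : Set α)ᶜ)) (by rw [ncard_compl', hS])
  have h2 : Nat.card (fixingSubgroup X ((S : Set α)ᶜ)) = Nat.card (GS X S) := by
    apply Nat.card_congr
    exact ⟨fun g => ⟨_, unlift_GS g⟩, fun g => lift_GS g.2, fun g => rfl, fun g => rfl⟩
  have h3 := Subgroup.card_mul_index (fixingSubgroup X ((S : Set α)ᶜ))
  rw [Nat.card_eq_fintype_card] at h1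
  have htm : t ≤ Fintype.card α := by omega
  have h4 := Nat.factorial_mul_descFactorial htm
  have h5 : (fixingSubgroup X ((S : Set α)ᶜ)).index = (Fintype.card α).descFactorial t := by
    apply Nat.eq_of_mul_eq_mul_right (Nat.factorial_pos (Fintype.card α - t))
    rw [h1, ← h4]; ring
  rw [← h3, h2, h5]; ring

theorem claimD {p : ℕ} (hp : 2 ≤ p) {X : Subgroup (Perm α)}
    (hX : Nat.Coprime (Nat.card X) p) (hB : ∀ k < Fintype.card α, Bd p k)
    (hprim : IsPreprimitive X α) (h2 : ¬ IsMultiplyPretransitive X α 2) :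
    ∀ n (S : Finset α), S.card = n → S ≠ Finset.univ → 1 ≤ n →
      n * Nat.card (GS X S) * p ≤ p ^ n := by
  intro n
  induction n using Nat.strong_induction_on with
  | _ n ih =>
  intro S hSn hSu hn
  have hSlt : S.card < Fintype.card α := by
    rw [Finset.card_lt_iff_ne_univ]; exact hSu
  rcases eq_or_lt_of_le hn with h1 | h1
  · -- n = 1
    have := L1S (p := p) (X := X) (S := S) (R := S) (GS_inv _ _) hX (hB _ hSlt)
    rw [sdiff_self, Finset.bot_eq_empty, GS_empty, mul_one, hSn, ← h1] at this
    have hF : FF p 1 = 1 := by simp [FF]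
    rw [hF] at this
    rw [← h1]
    simp only [one_mul, pow_one]
    nlinarith
  · have hnt : ¬ TransOn (GS X S) S := by
      intro h
      apply h2
      have hs := ncard_compl' S
      refine hprim.is_two_pretransitive (s := ((S : Set α)ᶜ)) (n := Fintype.card α - S.card - 1)
        (by omega) (by rw [Nat.card_eq_fintype_card]; omega) (link_trans h)
    have hSne : S.Nonempty := Finset.card_pos.1 (by omega)
    set H := GS X S with hH
    set Q := S.image (orb H) with hQ
    obtain ⟨O, hOQ, hOmax⟩ := Finset.exists_max_image Q Finset.card (hSne.image _)
    obtain ⟨a, haS, rfl⟩ := Finset.mem_image.1 hOQ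
    have hOS : orb H a ⊆ S := orb_sub (GS_inv _ _) haS
    have hSO : orb H a ≠ S := by
      intro h
      apply hnt
      intro x hx y hy
      rw [← h] at hx hy
      have := orb_eq hx
      rw [← this] at hy
      exact mem_orb.1 hy
    have hOlt : (orb H a).card < S.card := Finset.card_lt_card (lt_of_le_of_ne hOS hSO)
    have hO1 : 1 ≤ (orb H a).card := Finset.card_pos.2 ⟨a, self_mem_orb _ _⟩
    have hD := ih (orb H a).card (by omega) (orb H a) rfl
      (by intro h; rw [h] at hOlt; rw [Finset.card_univ] at hOlt; omega) hO1
    have hRinv : Inva H (S \ orb H a) := Inva_sdiff (GS_inv _ _) (orb_inv _ _)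
    have hML := ML (p := p) hp hRinv hX (fun k hk => hB k (by
      have := Finset.card_le_card (Finset.sdiff_subset : S \ orb H a ⊆ S)
      omega))
    rw [Finset.sdiff_sdiff_eq_self hOS, Finset.card_sdiff_of_subset hOS] at hML
    have hsum : S.card ≤ Q.card * (orb H a).card := by
      rw [← sum_orb (GS_inv X S), ← smul_eq_mul]
      exact Finset.sum_le_card_nsmul _ _ _ hOmax
    have hQim : Q.card ≤ ((S \ orb H a).image (orb H)).card + 1 := by
      have : Q ⊆ insert (orb H a) ((S \ orb H a).image (orb H)) := by
        intro D hD
        obtain ⟨b, hb, rfl⟩ := Finset.mem_image.1 hD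
        by_cases hba : b ∈ orb H a
        · rw [orb_eq hba]; exact Finset.mem_insert_self _ _
        · apply Finset.mem_insert_of_mem
          exact Finset.mem_image_of_mem _ (Finset.mem_sdiff.2 ⟨hb, hba⟩)
      exact (Finset.card_le_card this).trans (Finset.card_insert_le _ _)
    set f := ((S \ orb H a).image (orb H)).card
    set o := (orb H a).card
    have hf : f + 1 ≤ p ^ f := Nat.lt_pow_self (by omega)
    have hpo : p ^ n = p ^ (S.card - o) * p ^ o := by
      rw [← pow_add]; congr 1; omega
    have hpf : 0 < p ^ f := by positivity
    apply Nat.le_of_mul_le_mul_right _ hpf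
    calc n * Nat.card H * p * p ^ f = n * p * (Nat.card H * p ^ f) := by ring
      _ ≤ ((f+1) * o) * p * (p ^ (S.card - o) * Nat.card (GS X (orb H a))) := by
        gcongr
        rw [← hSn]
        exact hsum.trans (Nat.mul_le_mul_right _ hQim)
      _ = (f + 1) * p ^ (S.card - o) * (o * Nat.card (GS X (orb H a)) * p) := by ring
      _ ≤ p ^ f * p ^ (S.card - o) * p ^ o := by gcongr
      _ = p ^ n * p ^ f := by rw [hpo]; ring

theorem case_prim {p : ℕ} (hp : 2 ≤ p) {X : Subgroup (Perm α)}
    (hX : Nat.Coprime (Nat.card X) p) (hB : ∀ k < Fintype.card α, Bd p k)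
    (hprim : IsPreprimitive X α) (h2 : ¬ IsMultiplyPretransitive X α 2)
    (hm : 2 ≤ Fintype.card α) : Nat.card X ≤ FF p (Fintype.card α) := by
  have hne : Nonempty α := Fintype.card_pos_iff.1 (by omega)
  obtain ⟨v⟩ := hne
  have hc : ({v}ᶜ : Finset α).card = Fintype.card α - 1 := by simp [Finset.card_compl]
  have h1 := claimD hp hX hB hprim h2 _ ({v}ᶜ : Finset α) rfl
    (by intro h; have := Finset.mem_univ v; rw [← h] at this; simp at this) (by omega)
  have ht : IsMultiplyPretransitive X α 1 := is_one_pretransitive_iff.2 inferInstance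
  have h3 := card_mt ht (S := ({v}ᶜ : Finset α)) (by omega)
  rw [hc] at h1
  rw [FF_two hm, h3, Nat.descFactorial_one]
  obtain ⟨k, hk⟩ : ∃ k, Fintype.card α = k + 2 := ⟨Fintype.card α - 2, by omega⟩
  rw [hk] at h1 ⊢
  simp only [Nat.add_sub_cancel] at *
  have : k + 2 - 1 = k + 1 := by omega
  rw [this, pow_succ] at h1
  have h4 := Nat.le_of_mul_le_mul_right h1 (by omega)
  nlinarith

theorem mt_succ {X : Subgroup (Perm α)} {t : ℕ} (ht : IsMultiplyPretransitive X α t) {S : Finset α}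
    (hS : Fintype.card α - S.card = t) (hST : TransOn (GS X S) S) :
    IsMultiplyPretransitive X α (t + 1) := by
  rw [isMultiplyPretransitive_iff] at ht ⊢
  have hc : Sᶜ.card = t := by rw [Finset.card_compl, hS]
  let a : Fin t ↪ α := (Sᶜ.equivFinOfCardEq hc).symm.toEmbedding.trans (Function.Embedding.subtype _)
  have ha : ∀ b, b ∉ S → ∃ i, a i = b := by
    intro b hb
    refine ⟨Sᶜ.equivFinOfCardEq hc ⟨b, by simpa using hb⟩, ?_⟩
    simp [a]
  have key : ∀ x : Fin (t+1) ↪ α, ∃ g ∈ X, (∀ i, g (x (Fin.castSucc i)) = a i) ∧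
      g (x (Fin.last t)) ∈ S := by
    intro x
    obtain ⟨g, hg⟩ := ht (Fin.castSuccEmb.trans x) a
    have hg' : ∀ i, (g : Perm α) (x (Fin.castSucc i)) = a i := by
      intro i; exact congrArg (fun e : Fin t ↪ α => e i) hg
    refine ⟨g, g.2, hg', ?_⟩
    by_contra hcon
    obtain ⟨i, hi⟩ := ha _ hcon
    rw [← hg' i] at hi
    have := x.injective ((g : Perm α).injective hi)
    exact absurd this (Fin.castSucc_lt_last i).ne
  intro x y
  obtain ⟨g, hgX, hg, hgS⟩ := key x
  obtain ⟨h, hhX, hh, hhS⟩ := key y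
  obtain ⟨k, hk, hkk⟩ := hST _ hgS _ hhS
  refine ⟨⟨h⁻¹ * k * g, X.mul_mem (X.mul_mem (X.inv_mem hhX) hk.1) hgX⟩, ?_⟩
  ext i
  change (h⁻¹ * k * g) (x i) = y i
  rw [Perm.mul_apply, Perm.mul_apply, Perm.inv_eq_iff_eq]
  induction i using Fin.lastCases with
  | last => rw [hkk]
  | cast i =>
    rw [hg, hh]
    refine (mem_GS.1 hk).2 _ ?_
    have := (Sᶜ.equivFinOfCardEq hc).symm i
    have h5 := ((Sᶜ.equivFinOfCardEq hc).symm i).2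
    rw [Finset.mem_compl] at h5
    exact h5

theorem not_prim {X : Subgroup (Perm α)} {t : ℕ} (hprim : IsPreprimitive X α)
    (ht : ¬ IsMultiplyPretransitive X α (t+1)) (ht1 : 1 ≤ t) {S : Finset α}
    (hS : t + S.card ≤ Fintype.card α) (hS2 : 2 ≤ S.card) (hST : TransOn (GS X S) S) :
    ∃ B ⊆ S, Blk (GS X S) B ∧ 2 ≤ B.card ∧ B.card < S.card := by
  by_contra hcon
  push Not at hcon
  have hs := ncard_compl' S
  have := hprim.isMultiplyPreprimitive (s := ((S : Set α)ᶜ)) (n := Fintype.card α - S.card - 1)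
    (by omega) (by rw [Nat.card_eq_fintype_card]; omega) (link_prim hST (by
      intro B hBS hB
      by_contra h
      push Not at h
      have h3 := hcon B hBS hB (by omega)
      exact h.2 (Finset.eq_of_subset_of_card_le hBS h3)))
  have := this.isMultiplyPretransitive
  exact ht (isMultiplyPretransitive_of_le (n := Fintype.card α - S.card - 1 + 2) (by omega)
    (by rw [Nat.card_eq_fintype_card]; omega))
end CaseThree

open Equiv
section ClaimG
variable {α : Type} [Fintype α] [DecidableEq α]
open MulAction

theorem maxInv {H : Subgroup (Perm α)} {S : Finset α} {μ : ℕ} (hS : Inva H S) (hμ : μ ≤ S.card)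
    (hμ0 : 1 ≤ μ) (ho : ∀ a ∈ S, (orb H a).card < μ) :
    ∃ U ⊆ S, Inva H U ∧ U.card < μ ∧ μ ≤ 2 * U.card := by
  classical
  obtain ⟨U, hU, hmax⟩ := Finset.exists_max_image
    (S.powerset.filter (fun U => Inva H U ∧ U.card < μ)) Finset.card
    ⟨∅, by
      simp only [Finset.mem_filter, Finset.mem_powerset, Finset.empty_subset, true_and,
        Finset.card_empty]
      exact ⟨fun g _ a ha => absurd ha (Finset.notMem_empty a), hμ0⟩⟩
  simp only [Finset.mem_filter, Finset.mem_powerset] at hU hmax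
  obtain ⟨hUS, hUi, hUμ⟩ := hU
  refine ⟨U, hUS, hUi, hUμ, ?_⟩
  obtain ⟨a, haS, haU⟩ : ∃ a ∈ S, a ∉ U := by
    by_contra h
    push Not at h
    have := Finset.card_le_card (show S ⊆ U from h)
    omega
  have h1 := hmax (orb H a) ⟨orb_sub hS haS, orb_inv _ _, ho a haS⟩
  by_contra hcon
  have h2 := Finset.card_union_le U (orb H a)
  have h3 := hmax (U ∪ orb H a) ⟨Finset.union_subset hUS (orb_sub hS haS),
    Inva_union hUi (orb_inv _ _), by omega⟩
  have h4 : U.card < (U ∪ orb H a).card := by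
    apply Finset.card_lt_card
    refine ⟨Finset.subset_union_left, fun h => haU (h (Finset.mem_union_right _ (self_mem_orb _ _)))⟩
  omega

theorem orb_ne_of_not {H : Subgroup (Perm α)} {S : Finset α} (h : ¬ TransOn H S) (a : α) :
    orb H a ≠ S := by
  intro h'
  apply h
  intro x hx y hy
  rw [← h'] at hx hy
  rw [← orb_eq hx] at hy
  exact mem_orb.1 hy

theorem claimG {p μ t : ℕ} (hp : 3 ≤ p) {X : Subgroup (Perm α)}
    (hX : Nat.Coprime (Nat.card X) p) (hB : ∀ k < Fintype.card α, Bd p k)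
    (hprim : IsPreprimitive X α) (ht : ¬ IsMultiplyPretransitive X α (t+1)) (ht1 : 1 ≤ t)
    (hμ : 4 ≤ μ) (hmu : ∀ U : Finset α, U.card < μ → Nat.card (GS X U) = 1) :
    ∀ n (S : Finset α), S.card = n → t + n ≤ Fintype.card α → μ ≤ n →
      Nat.card (GS X S) * p ^ ((μ - 1) / 2 + 3) ≤ (p + 1) * p ^ n := by
  have hp2 : 2 ≤ p := by omega
  intro n
  induction n using Nat.strong_induction_on with
  | _ n ih =>
  intro S hSn htS hμn
  subst hSn
  have hp0 : 0 < p := by omega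
  by_cases hST : TransOn (GS X S) S
  · obtain ⟨B, hBS, hBB, hB2, hBlt⟩ := not_prim hprim ht ht1 htS (by omega) hST
    obtain ⟨c, hc, HU⟩ := BlkA (p := p) hBS (Finset.card_pos.1 (by omega)) hST hBB hX
      (hB _ (by omega))
    set b := B.card
    have hc2 : 2 ≤ c := by
      by_contra hcon
      have : c ≤ 1 := by omega
      have := Nat.mul_le_mul_right b this
      omega
    have hcS : c < S.card := by nlinarith
    have HU := HU (hB _ (by omega))
    by_cases hbμ : μ ≤ b
    · obtain ⟨U, hUS, hUc, hle⟩ := HU (c - 1) (by omega)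
      have : c - (c - 1) = 1 := by omega
      rw [this, one_mul] at hUc
      have h1 := ih b hBlt U hUc (by omega) hbμ
      have h2 : FF p c * FF p b ^ (c - 1) ≤ p ^ (S.card - b) := by
        calc FF p c * FF p b ^ (c - 1) ≤ p ^ (c - 1) * (p ^ (b - 1)) ^ (c - 1) := by
              gcongr
              · exact FF_le hp2 (by omega)
              · exact FF_le hp2 (by omega)
          _ = p ^ ((c - 1) + (b - 1) * (c - 1)) := by rw [← pow_mul, ← pow_add]
          _ = _ := by
            congr 1
            obtain ⟨b', hb'⟩ : ∃ b', b = b' + 1 := ⟨b - 1, by omega⟩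
            obtain ⟨c', hc'⟩ : ∃ c', c = c' + 1 := ⟨c - 1, by omega⟩
            rw [← hc, hb', hc']
            simp only [Nat.add_sub_cancel]
            have : (c' + 1) * (b' + 1) = c' + b' * c' + (b' + 1) := by ring
            omega
      have h3 : p ^ S.card = p ^ (S.card - b) * p ^ b := by
        rw [← pow_add]; congr 1; omega
      calc Nat.card (GS X S) * p ^ ((μ - 1) / 2 + 3)
          ≤ (p ^ (S.card - b) * Nat.card (GS X U)) * p ^ ((μ - 1) / 2 + 3) := by
            gcongr
            exact hle.trans (Nat.mul_le_mul_right _ h2)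
        _ = p ^ (S.card - b) * (Nat.card (GS X U) * p ^ ((μ - 1) / 2 + 3)) := by ring
        _ ≤ p ^ (S.card - b) * ((p + 1) * p ^ b) := by gcongr
        _ = _ := by rw [h3]; ring
    · push Not at hbμ
      set y := (μ - 1) / b with hy
      have hy1 : 1 ≤ y := (Nat.one_le_div_iff (by omega)).2 (by omega)
      have hyb : y * b ≤ μ - 1 := Nat.div_mul_le_self _ _
      have hyb' : μ - 1 < (y + 1) * b := by
        have := Nat.lt_mul_div_succ (μ - 1) (show 0 < b by omega)
        rw [mul_comm]; exact this
      have hyc : y < c := by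
        by_contra hcon
        push Not at hcon
        have := Nat.mul_le_mul_right b hcon
        omega
      obtain ⟨U, hUS, hUc, hle⟩ := HU (c - y) (by omega)
      have : c - (c - y) = y := by omega
      rw [this] at hUc
      rw [hmu U (by omega), mul_one] at hle
      obtain ⟨b', hb'⟩ : ∃ b', b = b' + 2 := ⟨b - 2, by omega⟩
      obtain ⟨c', hc'⟩ : ∃ c', c = c' + y + 1 := ⟨c - y - 1, by omega⟩
      obtain ⟨y', hy'⟩ : ∃ y', y = y' + 1 := ⟨y - 1, by omega⟩
      have hw : (μ - 1) / 2 ≤ y * (b - 1) := by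
        have h5 : μ - 1 < 2 * (y * (b - 1)) + 2 := by
          have : b - 1 = b' + 1 := by omega
          rw [this]
          rw [hb', hy'] at hyb'
          rw [hy']
          nlinarith [Nat.zero_le (y' * b')]
        omega
      have e1 : c - y = c' + 1 := by omega
      have hFb : FF p b ^ (c - y) ≤ 2 * p ^ b' * (p ^ (b' + 1)) ^ c' := by
        rw [e1, pow_succ, mul_comm]
        apply Nat.mul_le_mul
        · rw [FF_two hB2, hb']; simp
        · apply Nat.pow_le_pow_left
          have := FF_le hp2 (show 1 ≤ b by omega)
          rw [hb'] at this ⊢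
          exact this
      have hSc : S.card = (c' + y' + 2) * (b' + 2) := by
        rw [← hc, hc', hb', hy']; ring
      have hFc : FF p c = 2 * p ^ (c' + y') := by
        rw [FF_two hc2]; congr 2; omega
      have hw' : (μ - 1) / 2 ≤ (y' + 1) * (b' + 1) := by
        rw [hy', hb'] at hw; exact hw
      calc Nat.card (GS X S) * p ^ ((μ - 1) / 2 + 3)
          ≤ (2 * p ^ (c' + y') * (2 * p ^ b' * (p ^ (b' + 1)) ^ c')) *
              p ^ ((y' + 1) * (b' + 1) + 3) := by
            gcongr
            · rw [hFc] at hle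
              exact hle.trans (Nat.mul_le_mul_left _ hFb)
        _ = 4 * p ^ (c' + y' + b' + (b' + 1) * c' + ((y' + 1) * (b' + 1) + 3)) := by
            rw [← pow_mul, pow_add _ (c' + y' + b' + (b' + 1) * c'), pow_add _ (c' + y' + b'),
              pow_add _ (c' + y')]; ring
        _ = 4 * p ^ S.card := by
            rw [hSc]; congr 2; ring
        _ ≤ _ := by gcongr; omega
  · -- intransitive
    by_cases hO : ∃ a ∈ S, μ ≤ (orb (GS X S) a).card
    · obtain ⟨a, haS, haμ⟩ := hO
      set O := orb (GS X S) a with hOdef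
      have hOS : O ⊆ S := orb_sub (GS_inv _ _) haS
      have hOlt : O.card < S.card :=
        Finset.card_lt_card (lt_of_le_of_ne hOS (orb_ne_of_not hST a))
      have h1 := ih O.card hOlt O rfl (by omega) haμ
      have hcs : (S \ O).card = S.card - O.card := Finset.card_sdiff_of_subset hOS
      have h2 := L1S (p := p) (X := X) (S := S) (R := S \ O)
        (Inva_sdiff (GS_inv _ _) (orb_inv _ _)) hX (hB _ (by omega))
      rw [Finset.sdiff_sdiff_eq_self hOS, hcs] at h2
      have h4 : FF p (S.card - O.card) ≤ p ^ (S.card - O.card) :=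
        (FF_le hp2 (by omega)).trans (Nat.pow_le_pow_right hp0 (by omega))
      have h3 : p ^ S.card = p ^ (S.card - O.card) * p ^ O.card := by
        rw [← pow_add]; congr 1; omega
      calc Nat.card (GS X S) * p ^ ((μ - 1) / 2 + 3)
          ≤ (p ^ (S.card - O.card) * Nat.card (GS X O)) * p ^ ((μ - 1) / 2 + 3) := by
            gcongr
            exact h2.trans (Nat.mul_le_mul_right _ h4)
        _ = p ^ (S.card - O.card) * (Nat.card (GS X O) * p ^ ((μ - 1) / 2 + 3)) := by ring
        _ ≤ p ^ (S.card - O.card) * ((p + 1) * p ^ O.card) := by gcongr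
        _ = _ := by rw [h3]; ring
    · push Not at hO
      obtain ⟨U, hUS, hUi, hUμ, hU2⟩ := maxInv (GS_inv X S) hμn (by omega) hO
      have hcs : (S \ U).card = S.card - U.card := Finset.card_sdiff_of_subset hUS
      have h2 := L1S (p := p) (X := X) (S := S) (R := S \ U)
        (Inva_sdiff (GS_inv _ _) hUi) hX (hB _ (by omega))
      rw [Finset.sdiff_sdiff_eq_self hUS, hcs, hmu U hUμ, mul_one] at h2
      have h3 := h2.trans (FF_le hp2 (by omega))
      calc Nat.card (GS X S) * p ^ ((μ - 1) / 2 + 3)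
          ≤ p ^ (S.card - U.card - 1) * p ^ (U.card + 2) :=
            Nat.mul_le_mul h3 (Nat.pow_le_pow_right hp0 (by omega))
        _ = p * p ^ S.card := by rw [← pow_add, ← pow_succ']; congr 1; omega
        _ ≤ _ := by gcongr; omega
end ClaimG


theorem growth {p t A C : ℕ} (h : 75 ^ t ≤ p * 67 ^ t) (base : A * 67 ^ t ≤ C * p ^ 7) (w : ℕ)
    (hw : 7 ≤ w) : A * (8 * w + 11) ^ t ≤ C * p ^ w := by
  induction w, hw using Nat.le_induction with
  | base => simpa using base
  | succ w hw ih =>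
    have h1 : 67 * (8 * (w + 1) + 11) ≤ 75 * (8 * w + 11) := by omega
    have h2 := Nat.pow_le_pow_left h1 t
    rw [mul_pow, mul_pow] at h2
    have h3 : (8 * (w + 1) + 11) ^ t ≤ p * (8 * w + 11) ^ t := by
      apply Nat.le_of_mul_le_mul_left _ (show 0 < 67 ^ t by positivity)
      calc _ ≤ _ := h2
        _ ≤ (p * 67 ^ t) * (8 * w + 11) ^ t := by gcongr
        _ = _ := by ring
    calc _ ≤ A * (p * (8 * w + 11) ^ t) := by gcongr
      _ = p * (A * (8 * w + 11) ^ t) := by ring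
      _ ≤ p * (C * p ^ w) := by gcongr
      _ = _ := by ring

theorem boch_small {m μ : ℕ} (h4 : 4 ≤ μ) (h : ((μ - 1) / 3) * (m - μ) < (μ - 1) ^ 2)
    (hμ : μ < 15) : m < 60 := by
  interval_cases μ <;> simp at h <;> omega

theorem boch_large {m μ : ℕ} (h : ((μ - 1) / 3) * (m - μ) < (μ - 1) ^ 2)
    (hμ : 15 ≤ μ) : m ≤ 4 * μ + 3 := by
  by_contra hcon
  push Not at hcon
  obtain ⟨d, hd⟩ : ∃ d, m - μ = 3 * μ + 4 + d := ⟨m - μ - (3 * μ + 4), by omega⟩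
  rw [hd] at h
  obtain ⟨k, hk⟩ : ∃ k, μ = k + 3 := ⟨μ - 3, by omega⟩
  have h1 : k ≤ 3 * ((μ - 1) / 3) := by omega
  have h2 : μ - 1 = k + 2 := by omega
  have h3 : k * (3 * k + 13 + d) < 3 * (k + 2) ^ 2 := by
    calc k * (3 * k + 13 + d) ≤ 3 * ((μ - 1) / 3) * (3 * k + 13 + d) := by gcongr
      _ = 3 * (((μ - 1) / 3) * (3 * μ + 4 + d)) := by rw [hk]; ring
      _ < 3 * (μ - 1) ^ 2 := by omega
      _ = _ := by rw [h2]
  nlinarith [Nat.zero_le (k * d)]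

set_option synthInstance.maxSize 2000 in
set_option synthInstance.maxHeartbeats 200000 in
theorem numB_small : ∀ p ∈ [3, 5, 7], ∀ t < p, 2 ≤ t → ∀ μ < 15, 4 ≤ μ → ∀ m < 60,
    (t ≤ m % p ∧ ((μ - 1) / 3) * (m - μ) < (μ - 1) ^ 2) →
    (p + 1) * m.descFactorial t ≤ 2 * p ^ (t + (if t + 1 = p then p else 2) + (μ - 1) / 2) := by
  decide +kernel

theorem numB {p m μ t e : ℕ} (hp : p = 3 ∨ p = 5 ∨ p = 7) (ht2 : 2 ≤ t) (htp : t < p)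
    (hmod : t ≤ m % p) (he : 2 ≤ e) (he' : t + 1 = p → p ≤ e) (hμ : 4 ≤ μ)
    (hb : ((μ - 1) / 3) * (m - μ) < (μ - 1) ^ 2) :
    (p + 1) * m.descFactorial t ≤ 2 * p ^ (t + e + (μ - 1) / 2) := by
  have h0 : (if t + 1 = p then p else 2) ≤ e := by split_ifs with h; exact he' h; exact he
  suffices H : (p + 1) * m.descFactorial t ≤
      2 * p ^ (t + (if t + 1 = p then p else 2) + (μ - 1) / 2) by
    refine H.trans ?_
    gcongr
    omega
  by_cases h15 : μ < 15
  · exact numB_small p (by simpa using hp) t htp ht2 μ h15 hμ m (boch_small hμ hb h15)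
      ⟨hmod, hb⟩
  · push Not at h15
    have hm := boch_large hb h15
    set w := (μ - 1) / 2 with hw
    have hm' : m ≤ 8 * w + 11 := by omega
    have h1 : m.descFactorial t ≤ (8 * w + 11) ^ t :=
      (Nat.descFactorial_le_pow _ _).trans (Nat.pow_le_pow_left hm' _)
    refine (Nat.mul_le_mul_left _ h1).trans ?_
    rw [pow_add, ← mul_assoc]
    rcases hp with rfl | rfl | rfl <;> interval_cases t <;>
      exact growth (by norm_num) (by norm_num) w (by omega)

set_option synthInstance.maxSize 2000 in
set_option synthInstance.maxHeartbeats 200000 in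
theorem numC_small : ∀ p ∈ [3, 5, 7], ∀ t < p, 2 ≤ t → ∀ μ < 15, 4 ≤ μ → ∀ m < 60,
    (t ≤ m % p ∧ ((μ - 1) / 3) * (m - μ) < (μ - 1) ^ 2 ∧ p ≤ m) → ∀ u < μ, μ ≤ 2 * u →
    m.descFactorial t ≤ 2 * p ^ (t + u + (max 1 ((m - t - u + (μ - 2)) / (μ - 1))) - 2) := by
  decide +kernel

theorem numC {p m μ t u e : ℕ} (hp : p = 3 ∨ p = 5 ∨ p = 7) (ht2 : 2 ≤ t) (htp : t < p)
    (hmod : t ≤ m % p) (hμ : 4 ≤ μ) (hpm : p ≤ m)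
    (hb : ((μ - 1) / 3) * (m - μ) < (μ - 1) ^ 2) (hu : u < μ) (hu2 : μ ≤ 2 * u)
    (he1 : 1 ≤ e) (he : m - t - u ≤ e * (μ - 1)) :
    m.descFactorial t ≤ 2 * p ^ (t + u + e - 2) := by
  by_cases h15 : μ < 15
  · refine (numC_small p (by simpa using hp) t htp ht2 μ h15 hμ m (boch_small hμ hb h15)
      ⟨hmod, hb, hpm⟩ u hu hu2).trans ?_
    have : (m - t - u + (μ - 2)) / (μ - 1) ≤ e := by
      apply Nat.le_of_lt_succ
      rw [Nat.div_lt_iff_lt_mul (by omega)]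
      have : e.succ * (μ - 1) = e * (μ - 1) + (μ - 1) := Nat.succ_mul _ _
      omega
    have h3 : max 1 ((m - t - u + (μ - 2)) / (μ - 1)) ≤ e := max_le he1 this
    have h4 : 0 < p := by omega
    exact Nat.mul_le_mul_left _ (Nat.pow_le_pow_right h4 (by omega))
  · push Not at h15
    have hm := boch_large hb h15
    set w := (μ - 1) / 2 with hw
    have hm' : m ≤ 8 * w + 11 := by omega
    have h1 : m.descFactorial t ≤ (8 * w + 11) ^ t :=
      (Nat.descFactorial_le_pow _ _).trans (Nat.pow_le_pow_left hm' _)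
    have h2 : 2 * p ^ (t + w) ≤ 2 * p ^ (t + u + e - 2) := by
      have h4 : 0 < p := by omega
      gcongr
      omega
    refine h1.trans (le_trans ?_ h2)
    rw [pow_add, ← mul_assoc, ← one_mul ((8 * w + 11) ^ t)]
    rcases hp with rfl | rfl | rfl <;> interval_cases t <;>
      exact growth (by norm_num) (by norm_num) w (by omega)

theorem numR_small : ∀ μ < 15, ∀ m < 60, 4 ≤ μ →
    ((μ - 1) / 3) * (m - μ) < (μ - 1) ^ 2 → m.descFactorial (μ - 1) ≤ 11 ^ (μ - 1) * (μ - 1).factorial := by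
  decide +kernel

theorem choose_step (r : ℕ) (hr : 14 ≤ r) : (4 * r + 11).choose (r + 1) ≤ 11 * (4 * r + 7).choose r := by
  have h1 : (4 * r + 7).choose r * r.factorial * (3 * r + 7).factorial = (4 * r + 7).factorial := by
    have := Nat.choose_mul_factorial_mul_factorial (show r ≤ 4 * r + 7 by omega)
    rwa [show 4 * r + 7 - r = 3 * r + 7 by omega] at this
  have h2 : (4 * r + 11).choose (r + 1) * (r + 1).factorial * (3 * r + 10).factorial
      = (4 * r + 11).factorial := by
    have := Nat.choose_mul_factorial_mul_factorial (show r + 1 ≤ 4 * r + 11 by omega)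
    rwa [show 4 * r + 11 - (r + 1) = 3 * r + 10 by omega] at this
  have h3 : (4 * r + 11).factorial = (4 * r + 11) * (4 * r + 10) * (4 * r + 9) * (4 * r + 8) *
      (4 * r + 7).factorial := by
    simp only [Nat.factorial_succ]; ring
  have h4 : (3 * r + 10).factorial = (3 * r + 10) * (3 * r + 9) * (3 * r + 8) *
      (3 * r + 7).factorial := by
    simp only [Nat.factorial_succ]; ring
  rw [h3, h4, ← h1, Nat.factorial_succ] at h2
  have hpos : 0 < r.factorial * (3 * r + 7).factorial :=
    Nat.mul_pos (Nat.factorial_pos _) (Nat.factorial_pos _)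
  have h5 : (4 * r + 11).choose (r + 1) * ((r + 1) * (3 * r + 10) * (3 * r + 9) * (3 * r + 8)) =
      (4 * r + 11) * (4 * r + 10) * (4 * r + 9) * (4 * r + 8) * (4 * r + 7).choose r := by
    apply Nat.eq_of_mul_eq_mul_right hpos
    linarith
  have h6 : (4 * r + 11) * (4 * r + 10) * (4 * r + 9) * (4 * r + 8) ≤
      11 * ((r + 1) * (3 * r + 10) * (3 * r + 9) * (3 * r + 8)) := by
    obtain ⟨k, rfl⟩ : ∃ k, r = k + 14 := ⟨r - 14, by omega⟩
    ring_nf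
    nlinarith [Nat.zero_le (k ^ 2), Nat.zero_le (k ^ 3), Nat.zero_le (k ^ 4), Nat.zero_le k]
  apply Nat.le_of_mul_le_mul_right _
    (show 0 < (r + 1) * (3 * r + 10) * (3 * r + 9) * (3 * r + 8) by positivity)
  rw [h5]
  calc _ ≤ 11 * ((r + 1) * (3 * r + 10) * (3 * r + 9) * (3 * r + 8)) * (4 * r + 7).choose r := by
        gcongr
    _ = _ := by ring

theorem choose_bound (r : ℕ) (hr : 14 ≤ r) : (4 * r + 7).choose r ≤ 11 ^ r := by
  induction r, hr using Nat.le_induction with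
  | base =>
    rw [Nat.choose_eq_descFactorial_div_factorial]
    decide +kernel
  | succ r hr ih =>
    have := choose_step r hr
    rw [show 4 * (r + 1) + 7 = 4 * r + 11 by omega, pow_succ]
    omega

theorem numR {m μ : ℕ} (hμ : 4 ≤ μ) (hb : ((μ - 1) / 3) * (m - μ) < (μ - 1) ^ 2) :
    m.choose (μ - 1) ≤ 11 ^ (μ - 1) := by
  by_cases h15 : μ < 15
  · have := numR_small μ h15 m (boch_small hμ hb h15) hμ hb
    rw [Nat.choose_eq_descFactorial_div_factorial]
    exact Nat.div_le_of_le_mul (by rwa [mul_comm])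
  · push Not at h15
    have hm := boch_large hb h15
    refine (Nat.choose_le_choose _ (show m ≤ 4 * (μ - 1) + 7 by omega)).trans ?_
    exact choose_bound _ (by omega)

theorem fact_bound (m : ℕ) : (m + 2).factorial ≤ 2 * (m + 2) ^ m := by
  induction m with
  | zero => simp [Nat.factorial]
  | succ m ih =>
    rw [Nat.factorial_succ]
    calc (m + 2 + 1) * (m + 2).factorial ≤ (m + 3) * (2 * (m + 3) ^ m) := by
          apply Nat.mul_le_mul_left
          refine ih.trans ?_
          gcongr
          omega
      _ = _ := by ring

theorem numA {p t m : ℕ} (hp : 2 ≤ p) (htp : t < p) (hm : p ≤ m) :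
    m.descFactorial t ≤ 2 * p ^ (m - 2) := by
  induction m, hm using Nat.le_induction with
  | base =>
    obtain ⟨k, rfl⟩ : ∃ k, p = k + 2 := ⟨p - 2, by omega⟩
    have h := fact_bound k
    have h2 := Nat.factorial_mul_descFactorial htp.le
    have : (k + 2).descFactorial t ≤ (k + 2).factorial := by
      rw [← h2]; exact Nat.le_mul_of_pos_left _ (Nat.factorial_pos _)
    simpa using this.trans h
  | succ m hm ih =>
    have h1 := Nat.succ_descFactorial m t
    have h2 : m + 1 ≤ p * (m + 1 - t) := by
      obtain ⟨d, hd⟩ : ∃ d, m = p + d := ⟨m - p, by omega⟩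
      obtain ⟨f, hf⟩ : ∃ f, p = t + 1 + f := ⟨p - t - 1, by omega⟩
      have : m + 1 - t = d + f + 2 := by omega
      rw [this]
      nlinarith [Nat.zero_le (p * f), Nat.zero_le (p*d)]
    have h3 : (m + 1).descFactorial t ≤ p * m.descFactorial t := by
      apply Nat.le_of_mul_le_mul_left _ (show 0 < m + 1 - t by omega)
      rw [h1]
      calc _ ≤ (p * (m + 1 - t)) * m.descFactorial t := by gcongr
        _ = _ := by ring
    calc _ ≤ _ := h3
      _ ≤ p * (2 * p ^ (m - 2)) := by gcongr
      _ = 2 * p ^ (m - 2 + 1) := by ring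
      _ = _ := by congr 2; omega

open Equiv
section Bochert
variable {α : Type} [Fintype α] [DecidableEq α]
open MulAction

theorem pinv (g : Perm α) (a : α) : g (g⁻¹ a) = a := by simp

theorem comm_support (g h : Perm α) (K : Finset α)
    (hK : ∀ a, g a ≠ a → h a ≠ a → a ∈ K) :
    (g * h * g⁻¹ * h⁻¹).support ⊆ K ∪ (K.image g ∪ K.image h) := by
  intro a ha
  by_contra hcon
  simp only [Finset.mem_union, Finset.mem_image, not_or, not_exists, not_and] at hcon
  obtain ⟨h1, h2, h3⟩ := hcon
  rw [Perm.mem_support] at ha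
  apply ha
  simp only [Perm.mul_apply]
  by_cases hha : h a = a
  · have e1 : h⁻¹ a = a := by rw [Perm.inv_eq_iff_eq, hha]
    rw [e1]
    have e2 : h (g⁻¹ a) = g⁻¹ a := by
      by_contra hne
      by_cases hg : g (g⁻¹ a) = g⁻¹ a
      · rw [pinv] at hg
        rw [← hg] at hne
        exact hne hha
      · exact h2 _ (hK _ hg hne) (by simp)
    rw [e2]; simp
  · have hga : g a = a := by
      by_contra hne; exact h1 (hK _ hne hha)
    have e3 : h (h⁻¹ a) ≠ h⁻¹ a := by
      rw [pinv]
      intro hh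
      apply hha
      conv_lhs => rw [hh]
      simp
    have e4 : g (h⁻¹ a) = h⁻¹ a := by
      by_contra hne
      exact h3 _ (hK _ hne e3) (by simp)
    have e5 : g⁻¹ (h⁻¹ a) = h⁻¹ a := by rw [Perm.inv_eq_iff_eq, e4]
    rw [e5, pinv, hga]

open Classical in
theorem bochert {X : Subgroup (Perm α)} (h2 : IsMultiplyPretransitive X α 2) {g : Perm α}
    (hg : g ∈ X) (hg1 : g ≠ 1) (hmin : ∀ h ∈ X, h ≠ 1 → g.support.card ≤ h.support.card) :
    ((g.support.card - 1) / 3) * (Fintype.card α - g.support.card) < (g.support.card - 1) ^ 2 := by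
  set S := g.support with hS
  set μ := S.card with hμ
  have hμ2 : 2 ≤ μ := Perm.two_le_card_support_of_ne_one hg1
  rw [is_two_pretransitive_iff] at h2
  obtain ⟨a0, ha0⟩ : S.Nonempty := Finset.card_pos.1 (by omega)
  set b0 := g a0 with hb0
  have hab0 : a0 ≠ b0 := (Perm.mem_support.1 ha0).symm
  set N := (Finset.univ.filter (fun y : X => (y : Perm α) a0 = a0 ∧ (y : Perm α) b0 = b0)).card
    with hN
  have hNc : ∀ a b u v : α, a ≠ b → u ≠ v →
      (Finset.univ.filter (fun y : X => (y : Perm α) a = u ∧ (y : Perm α) b = v)).card = N := by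
    intro a b u v hab huv
    obtain ⟨z, hz1, hz2⟩ := h2 hab0 hab
    obtain ⟨w, hw1, hw2⟩ := h2 hab0 huv
    apply Finset.card_bij (fun y _ => w⁻¹ * y * z)
    · intro y hy
      simp only [Finset.mem_filter, Finset.mem_univ, true_and] at hy ⊢
      have hz1' : (z : Perm α) a0 = a := hz1
      have hz2' : (z : Perm α) b0 = b := hz2
      have hw1' : (w : Perm α) a0 = u := hw1
      have hw2' : (w : Perm α) b0 = v := hw2
      simp only [Subgroup.coe_mul, Subgroup.coe_inv, Perm.mul_apply, hz1', hz2', hy.1, hy.2,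
        Perm.inv_eq_iff_eq, hw1', hw2', and_self]
    · intro y _ y' _ hyy
      simpa using hyy
    · intro y hy
      simp only [Finset.mem_filter, Finset.mem_univ, true_and] at hy
      refine ⟨w * y * z⁻¹, ?_, by group⟩
      have hz1' : (z : Perm α)⁻¹ a = a0 := Perm.inv_eq_iff_eq.2 hz1.symm
      have hz2' : (z : Perm α)⁻¹ b = b0 := Perm.inv_eq_iff_eq.2 hz2.symm
      simp only [Finset.mem_filter, Finset.mem_univ, true_and, Subgroup.coe_mul, Subgroup.coe_inv,
        Perm.mul_apply, hz1', hz2', hy.1, hy.2]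
      exact ⟨hw1, hw2⟩
  have hNP : ∀ (P : Finset (α × α)) (a b : α), a ≠ b → (∀ q ∈ P, q.1 ≠ q.2) →
      (Finset.univ.filter (fun y : X => ((y : Perm α) a, (y : Perm α) b) ∈ P)).card = P.card * N := by
    intro P a b hab hP
    rw [Finset.card_eq_sum_card_fiberwise (t := P)
      (f := fun y : X => ((y : Perm α) a, (y : Perm α) b))]
    · rw [Finset.sum_const_nat]
      intro q hq
      rw [← hNc a b q.1 q.2 hab (hP q hq)]
      congr 1
      ext y
      simp only [Finset.mem_filter, Finset.mem_univ, true_and]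
      constructor
      · rintro ⟨_, h⟩; rw [← h]; exact ⟨rfl, rfl⟩
      · rintro ⟨h, h'⟩; rw [h, h']; exact ⟨hq, rfl⟩
    · intro y hy
      simpa using hy
  let k : X → Finset α := fun y => S.filter (fun a => (y : Perm α) a ∈ S)
  let b : X → Finset α := fun y => S.filter (fun a => (y : Perm α) a ∈ S ∧ (y : Perm α) (g a) ∉ S)
  have hsumb : ∑ y : X, (b y).card = μ * (μ * (Fintype.card α - μ)) * N := by
    simp only [b, Finset.card_filter]
    rw [Finset.sum_comm, mul_assoc, hμ, Finset.sum_const_nat]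
    intro a ha
    rw [← Finset.card_filter]
    have hP := hNP (S ×ˢ Sᶜ) a (g a) (Perm.mem_support.1 ha).symm (by
      rintro ⟨u, v⟩ hq
      simp only [Finset.mem_product, Finset.mem_compl] at hq
      intro (h : u = v)
      rw [h] at hq; exact hq.2 hq.1)
    rw [Finset.card_product, Finset.card_compl] at hP
    rw [← hμ] at hP ⊢
    rw [← hP]
    congr 1
    ext y
    simp
  have hsumk : ∑ y : X, (k y).offDiag.card = (μ * μ - μ) * ((μ * μ - μ) * N) := by
    have h1 : ∀ y : X, (k y).offDiag.card = ∑ q ∈ S.offDiag,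
        if ((y : Perm α) q.1, (y : Perm α) q.2) ∈ S.offDiag then 1 else 0 := by
      intro y
      rw [← Finset.card_filter]
      congr 1
      ext ⟨u, v⟩
      simp only [k, Finset.mem_offDiag, Finset.mem_filter, ne_eq, EmbeddingLike.apply_eq_iff_eq]
      tauto
    simp only [h1]
    rw [Finset.sum_comm, ← Finset.offDiag_card, Finset.sum_const_nat]
    intro q hq
    rw [← Finset.card_filter]
    rw [Finset.mem_offDiag] at hq
    exact hNP S.offDiag q.1 q.2 hq.2.2 (fun r hr => (Finset.mem_offDiag.1 hr).2.2)
  have hle : ∀ y : X, ((μ - 1) / 3) * (b y).card ≤ (k y).offDiag.card := by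
    intro y
    rcases (b y).eq_empty_or_nonempty with h0 | ⟨a, ha⟩
    · rw [h0]; simp
    · have hbk : (b y).card ≤ (k y).card := by
        apply Finset.card_le_card
        intro c hc
        simp only [b, k, Finset.mem_filter] at hc ⊢
        exact ⟨hc.1, hc.2.1⟩
      simp only [b, Finset.mem_filter] at ha
      obtain ⟨haS, hyS, hyn⟩ := ha
      set h : Perm α := (y : Perm α)⁻¹ * g * y with hh
      have hhm : ∀ c, h c ≠ c ↔ (y : Perm α) c ∈ S := by
        intro c
        rw [hS, Perm.mem_support, hh]
        simp only [Perm.mul_apply, ne_eq, Perm.inv_eq_iff_eq]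
      have hhX : h ∈ X := X.mul_mem (X.mul_mem (X.inv_mem y.2) hg) y.2
      have hne : g * h * g⁻¹ * h⁻¹ ≠ 1 := by
        intro he
        have he' : g * h = h * g := by
          have := mul_inv_eq_one.1 he
          exact mul_inv_eq_iff_eq_mul.1 this
        have e1 : h (g a) = g a := by
          by_contra hc; exact hyn ((hhm _).1 hc)
        have e2 : g (h a) = g a := by
          have := congrArg (fun e : Perm α => e a) he'
          simp only [Perm.mul_apply] at this
          rw [this, e1]
        exact (hhm a).2 hyS (g.injective e2)
      have hmem : g * h * g⁻¹ * h⁻¹ ∈ X :=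
        X.mul_mem (X.mul_mem (X.mul_mem hg hhX) (X.inv_mem hg)) (X.inv_mem hhX)
      have h5 := hmin _ hmem hne
      have h6 := Finset.card_le_card (comm_support g h (k y) (by
        intro c hc1 hc2
        simp only [k, Finset.mem_filter]
        exact ⟨Perm.mem_support.2 hc1, (hhm c).1 hc2⟩))
      have h7 := Finset.card_union_le (k y) ((k y).image g ∪ (k y).image h)
      have h8 := Finset.card_union_le ((k y).image g) ((k y).image h)
      have h9 : ((k y).image g).card ≤ (k y).card := Finset.card_image_le
      have h10 : ((k y).image h).card ≤ (k y).card := Finset.card_image_le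
      have h11 : μ ≤ 3 * (k y).card := by omega
      rw [Finset.offDiag_card]
      have h12 : (μ - 1) / 3 ≤ (k y).card - 1 := by omega
      calc ((μ - 1) / 3) * (b y).card ≤ ((k y).card - 1) * (k y).card := Nat.mul_le_mul h12 hbk
        _ = _ := by rw [Nat.sub_mul, one_mul]
  have hlt : ((μ - 1) / 3) * (b 1).card < (k 1).offDiag.card := by
    have e1 : b 1 = ∅ := by
      apply Finset.eq_empty_of_forall_notMem
      intro c hc
      have hc' := Finset.mem_filter.1 hc
      exact hc'.2.2 (Perm.apply_mem_support.2 hc'.1)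
    have e2 : k 1 = S := by
      exact Finset.filter_true_of_mem (fun a ha => ha)
    rw [e1, e2, Finset.offDiag_card, ← hμ]
    have : μ * 2 ≤ μ * μ := Nat.mul_le_mul_left _ hμ2
    simp only [Finset.card_empty, mul_zero]
    omega
  have hs := Finset.sum_lt_sum (s := Finset.univ) (fun y _ => hle y) ⟨1, Finset.mem_univ _, hlt⟩
  rw [← Finset.mul_sum, hsumb, hsumk] at hs
  obtain ⟨ν, hν⟩ : ∃ ν, μ = ν + 1 := ⟨μ - 1, by omega⟩
  have e3 : μ * μ - μ = μ * (μ - 1) := by rw [Nat.mul_sub, mul_one]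
  rw [e3] at hs
  have hs' : (μ * μ * N) * ((μ - 1) / 3 * (Fintype.card α - μ)) < (μ * μ * N) * (μ - 1) ^ 2 := by
    calc _ = (μ - 1) / 3 * (μ * (μ * (Fintype.card α - μ)) * N) := by ring
      _ < _ := hs
      _ = _ := by ring
  exact lt_of_mul_lt_mul_left hs' (Nat.zero_le _)
end Bochert

open Equiv
section RSub
variable {α : Type} [Fintype α] [DecidableEq α]
open MulAction
open scoped Pointwise

theorem GS_triv {X : Subgroup (Perm α)} {μ : ℕ}
    (hmin : ∀ h ∈ X, h ≠ 1 → μ ≤ h.support.card) (U : Finset α) (hU : U.card < μ) :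
    Nat.card (GS X U) = 1 := by
  have : GS X U = ⊥ := by
    rw [eq_bot_iff]
    intro g hg
    rw [mem_GS] at hg
    rw [Subgroup.mem_bot]
    by_contra hne
    have h1 := hmin g hg.1 hne
    have h2 : g.support ⊆ U := by
      intro a ha
      by_contra hn
      exact Perm.mem_support.1 ha (hg.2 a hn)
    have := Finset.card_le_card h2
    omega
  rw [this]; simp

theorem rsub {p : ℕ} {X : Subgroup (Perm α)} (hX : Nat.Coprime (Nat.card X) p)
    (U : Finset α) (hU : Nat.card (GS X U) = 1) (hB : Bd p (Fintype.card α - U.card)) :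
    Nat.card X ≤ (Fintype.card α).choose U.card * FF p (Fintype.card α - U.card) := by
  classical
  set H : Subgroup (Perm α) := X ⊓ MulAction.stabilizer (Perm α) U with hH
  have hHX : H ≤ X := inf_le_left
  have h1 : Nat.card (MulAction.stabilizer X U) = Nat.card H := by
    apply Nat.card_congr
    exact ⟨fun g => ⟨g.1.1, g.1.2, g.2⟩, fun g => ⟨⟨g.1, g.2.1⟩, g.2.2⟩, fun g => rfl, fun g => rfl⟩
  have h2 : Nat.card X = (MulAction.stabilizer X U).index * Nat.card H := by
    rw [← h1, Subgroup.index_mul_card]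
  have h3 : (MulAction.stabilizer X U).index ≤ (Fintype.card α).choose U.card := by
    rw [MulAction.index_stabilizer]
    have : MulAction.orbit X U ⊆ ((Finset.powersetCard U.card Finset.univ : Finset (Finset α)) : Set (Finset α)) := by
      rintro _ ⟨g, rfl⟩
      simp only [Finset.subset_univ, true_and, Finset.mem_coe, Finset.mem_powersetCard]
      exact Finset.card_smul_finset _ _
    refine (Set.ncard_le_ncard this (Finset.finite_toSet _)).trans ?_
    rw [Set.ncard_coe_finset, Finset.card_powersetCard, Finset.card_univ]
  have hinv : Inva H Uᶜ := by
    intro g hg a ha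
    rw [Finset.mem_compl] at *
    intro hga
    apply ha
    have h5 : g • U = U := hg.2
    rw [← h5] at hga
    exact Finset.smul_mem_smul_finset_iff g |>.1 hga
  have h4 := L1 (p := p) (H := H) Uᶜ hinv (coprime_of_le hHX hX) (by rwa [Finset.card_compl])
  have h6 : Nat.card (Fx H Uᶜ) ≤ Nat.card (GS X U) := by
    apply Nat.card_le_card_of_injective
      (fun g : Fx H Uᶜ => (⟨g.1, hHX g.2.1, g.2.2⟩ : GS X U))
    intro a b hab
    have := congrArg Subtype.val hab
    exact Subtype.ext this
  rw [hU] at h6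
  rw [Finset.card_compl] at h4
  rw [h2]
  refine Nat.mul_le_mul h3 (h4.trans ?_)
  calc _ ≤ FF p (Fintype.card α - U.card) * 1 := Nat.mul_le_mul_left _ h6
    _ = _ := mul_one _

theorem case_big {p μ : ℕ} (hp : 11 ≤ p) {X : Subgroup (Perm α)}
    (hX : Nat.Coprime (Nat.card X) p) (hB : ∀ k < Fintype.card α, Bd p k)
    (hμ : 4 ≤ μ) (hμm : μ ≤ Fintype.card α)
    (hmin : ∀ h ∈ X, h ≠ 1 → μ ≤ h.support.card)
    (hb : ((μ - 1) / 3) * (Fintype.card α - μ) < (μ - 1) ^ 2) :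
    Nat.card X ≤ 2 * p ^ (Fintype.card α - 2) := by
  obtain ⟨U, _, hU⟩ := Finset.exists_subset_card_eq (s := (Finset.univ : Finset α)) (n := μ - 1)
    (by rw [Finset.card_univ]; omega)
  have h1 := rsub (p := p) hX U (GS_triv hmin U (by omega)) (hB _ (by omega))
  rw [hU] at h1
  refine h1.trans ?_
  rcases eq_or_lt_of_le hμm with h | h
  · rw [← h]
    have e1 : μ - (μ - 1) = 1 := by omega
    have e2 : FF p 1 = 1 := by simp [FF]
    rw [e1, e2, mul_one, Nat.choose_symm_of_eq_add (show μ = (μ - 1) + 1 by omega), Nat.choose_one_right]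
    have : μ - 1 < 2 ^ (μ - 1) := Nat.lt_two_pow_self
    have e3 : 2 ^ (μ - 1) = 2 * 2 ^ (μ - 2) := by
      rw [← pow_succ', show μ - 2 + 1 = μ - 1 by omega]
    have : 2 ^ (μ - 2) ≤ p ^ (μ - 2) := Nat.pow_le_pow_left (by omega) _
    omega
  · have h2 := numR hμ hb
    have h3 : 11 ^ (μ - 1) ≤ p ^ (μ - 1) := Nat.pow_le_pow_left (by omega) _
    rw [FF_two (by omega)]
    calc _ ≤ p ^ (μ - 1) * (2 * p ^ (Fintype.card α - (μ - 1) - 2)) :=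
          Nat.mul_le_mul_right _ (h2.trans h3)
      _ = 2 * p ^ ((μ - 1) + (Fintype.card α - (μ - 1) - 2)) := by rw [pow_add]; ring
      _ = _ := by congr 2; omega

theorem rot {p : ℕ} (hp : p.Prime) (hp3 : 3 ≤ p) {X : Subgroup (Perm α)}
    (hX : Nat.Coprime (Nat.card X) p) (ht : IsMultiplyPretransitive X α (p - 1))
    (hpm : p ≤ Fintype.card α) :
    ∃ S : Finset α, Fintype.card α - S.card = p - 1 ∧ p ≤ (S.image (orb (GS X S))).card := by
  classical
  have : Fact p.Prime := ⟨hp⟩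
  have : NeZero p := ⟨hp.ne_zero⟩
  obtain ⟨f⟩ : Nonempty (ZMod p ↪ α) := by
    apply Function.Embedding.nonempty_of_card_le
    rw [ZMod.card]; exact hpm
  let J := {k : ZMod p // k ≠ 0}
  have hJ : Fintype.card J = p - 1 := by
    rw [Fintype.card_subtype_compl]; simp [ZMod.card]
  let eJ : Fin (p - 1) ≃ J := (Fintype.equivFinOfCardEq hJ).symm
  let x : ZMod p → (Fin (p - 1) ↪ α) := fun i =>
    ⟨fun k => f ((eJ k : ZMod p) + i), fun a b hab => by
      have := f.injective hab
      exact eJ.injective (Subtype.ext (add_right_cancel this))⟩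
  have hg : ∀ i : ZMod p, ∃ g ∈ X, ∀ k : ZMod p, k ≠ 0 → g (f (k + i)) = f k := by
    intro i
    obtain ⟨g, hg⟩ := ht.exists_smul_eq (x i) (x 0)
    refine ⟨g, g.2, fun k hk => ?_⟩
    have := congrArg (fun z : Fin (p - 1) ↪ α => z (eJ.symm ⟨k, hk⟩)) hg
    have h : (g : Perm α) (f ((eJ (eJ.symm ⟨k, hk⟩) : ZMod p) + i))
        = f ((eJ (eJ.symm ⟨k, hk⟩) : ZMod p) + 0) := this
    rw [Equiv.apply_symm_apply, add_zero] at h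
    exact h
  choose g hgX hg using hg
  set T : Finset α := (Finset.univ.filter (fun k : ZMod p => k ≠ 0)).image f with hT
  have hTc : T.card = p - 1 := by
    rw [hT, Finset.card_image_of_injective _ f.injective, ← Fintype.card_subtype, hJ]
  have hmT : ∀ a, a ∈ T ↔ ∃ k : ZMod p, k ≠ 0 ∧ f k = a := by
    intro a; simp [hT]
  refine ⟨Tᶜ, ?_, ?_⟩
  · rw [Finset.card_compl, hTc]; omega
  · set z : ZMod p → α := fun i => g i (f i) with hz
    have hzS : ∀ i, z i ∈ Tᶜ := by
      intro i
      rw [Finset.mem_compl, hmT]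
      rintro ⟨k, hk, hk2⟩
      rw [← hg i k hk] at hk2
      have := f.injective ((g i).injective hk2)
      exact hk (by simpa using this)
    have hinj : Function.Injective (fun i => orb (GS X Tᶜ) (z i)) := by
      intro i j hij
      by_contra hne
      have : z j ∈ orb (GS X Tᶜ) (z i) := by
        have h0 : orb (GS X Tᶜ) (z i) = orb (GS X Tᶜ) (z j) := hij
        rw [h0]; exact self_mem_orb _ _
      obtain ⟨h, hh, hhz⟩ := mem_orb.1 this
      rw [mem_GS] at hh
      set w := (g j)⁻¹ * h * g i with hw
      have hwX : w ∈ X := X.mul_mem (X.mul_mem (X.inv_mem (hgX j)) hh.1) (hgX i)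
      have hwf : ∀ k, w (f (k + i)) = f (k + j) := by
        intro k
        rw [hw]
        simp only [Perm.mul_apply]
        rw [Perm.inv_eq_iff_eq]
        by_cases hk : k = 0
        · subst hk
          rw [zero_add, zero_add]; exact hhz
        · rw [hg i k hk, hg j k hk]
          apply hh.2
          rw [Finset.mem_compl, not_not, hmT]
          exact ⟨k, hk, rfl⟩
      have hwf' : ∀ k, w (f k) = f (k + (j - i)) := by
        intro k
        have := hwf (k - i)
        rw [sub_add_cancel] at this
        rw [this]; congr 1; ring
      have hpow : ∀ n : ℕ, (w ^ n) (f 0) = f (n * (j - i)) := by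
        intro n
        induction n with
        | zero => simp
        | succ n ih =>
          rw [pow_succ', Perm.mul_apply, ih, hwf']; congr 1; push_cast; ring
      have hord : p ∣ orderOf w := by
        have h1 := hpow (orderOf w)
        rw [pow_orderOf_eq_one, Perm.one_apply] at h1
        have h2 := (f.injective h1).symm
        rcases mul_eq_zero.1 h2 with h3 | h3
        · exact (ZMod.natCast_eq_zero_iff _ _).1 h3
        · exact absurd (sub_eq_zero.1 h3).symm hne
      have hd : orderOf w ∣ Nat.card X := Subgroup.orderOf_dvd_natCard X hwX
      have := Nat.dvd_gcd (hord.trans hd) (dvd_refl p)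
      rw [hX] at this
      exact hp.one_lt.ne' (Nat.dvd_one.1 this)
    calc p = (Finset.univ : Finset (ZMod p)).card := by rw [Finset.card_univ, ZMod.card]
      _ = (Finset.univ.image (fun i => orb (GS X Tᶜ) (z i))).card :=
        (Finset.card_image_of_injective _ hinj).symm
      _ ≤ _ := by
        apply Finset.card_le_card
        intro O hO
        obtain ⟨i, _, rfl⟩ := Finset.mem_image.1 hO
        exact Finset.mem_image_of_mem _ (hzS i)
end RSub

open Equiv
section Two
variable {α : Type} [Fintype α] [DecidableEq α]
open MulAction

theorem not_p_trans {p : ℕ} (hp : p.Prime) {X : Subgroup (Perm α)}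
    (hX : Nat.Coprime (Nat.card X) p) (hpm : p ≤ Fintype.card α) :
    ¬ IsMultiplyPretransitive X α p := by
  intro h
  obtain ⟨S, _, hS⟩ := Finset.exists_subset_card_eq (s := (Finset.univ : Finset α))
    (n := Fintype.card α - p) (by rw [Finset.card_univ]; omega)
  have h1 := card_mt h (S := S) (by omega)
  have h2 : p ∣ Nat.card X := by
    rw [h1]
    exact Dvd.dvd.mul_right (((Nat.dvd_factorial hp.pos le_rfl)).trans
      (Nat.factorial_dvd_descFactorial _ _)) _
  have := Nat.dvd_gcd h2 (dvd_refl p)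
  rw [hX] at this
  exact hp.one_lt.ne' (Nat.dvd_one.1 this)

theorem two_orb {H : Subgroup (Perm α)} {S : Finset α} (hne : S.Nonempty) (hS : Inva H S)
    (h : ¬ TransOn H S) : 2 ≤ (S.image (orb H)).card := by
  by_contra hc
  obtain ⟨a, ha⟩ := hne
  apply orb_ne_of_not h a
  apply Finset.Subset.antisymm (orb_sub hS ha)
  intro b hb
  have : orb H b = orb H a :=
    Finset.card_le_one.1 (by omega) _ (Finset.mem_image_of_mem _ hb) _ (Finset.mem_image_of_mem _ ha)
  rw [← this]; exact self_mem_orb _ _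

theorem case_small {p μ : ℕ} (hp' : p = 3 ∨ p = 5 ∨ p = 7) (hp : p.Prime) {X : Subgroup (Perm α)}
    (hX : Nat.Coprime (Nat.card X) p) (hB : ∀ k < Fintype.card α, Bd p k)
    (hprim : IsPreprimitive X α) (h2 : IsMultiplyPretransitive X α 2)
    (hpm : p ≤ Fintype.card α) (hμ : 4 ≤ μ)
    (hmin : ∀ h ∈ X, h ≠ 1 → μ ≤ h.support.card)
    (hb : ((μ - 1) / 3) * (Fintype.card α - μ) < (μ - 1) ^ 2) :
    Nat.card X ≤ 2 * p ^ (Fintype.card α - 2) := by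
  have hp3 : 3 ≤ p := by omega
  have hmu := GS_triv hmin
  obtain ⟨t, ht2, htp, hti, htn⟩ : ∃ t, 2 ≤ t ∧ t < p ∧ IsMultiplyPretransitive X α t ∧
      ¬ IsMultiplyPretransitive X α (t + 1) := by
    by_contra hcon
    push Not at hcon
    have : ∀ t, 2 ≤ t → t ≤ p → IsMultiplyPretransitive X α t := by
      intro t ht
      induction t, ht using Nat.le_induction with
      | base => intro _; exact h2
      | succ t ht ih => intro hh; exact hcon t ht (by omega) (ih (by omega))
    exact not_p_trans hp hX hpm (this p (by omega) le_rfl)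
  set m := Fintype.card α with hm
  obtain ⟨S, hSt, hSp⟩ : ∃ S : Finset α, m - S.card = t ∧
      (t + 1 = p → p ≤ (S.image (orb (GS X S))).card) := by
    by_cases htp1 : t + 1 = p
    · obtain ⟨S, h1, h2⟩ := rot hp hp3 hX (by rw [← htp1]; exact hti) hpm
      exact ⟨S, by omega, fun _ => h2⟩
    · obtain ⟨S, _, hS⟩ := Finset.exists_subset_card_eq (s := (Finset.univ : Finset α))
        (n := m - t) (by rw [Finset.card_univ]; omega)
      exact ⟨S, by omega, fun h => absurd h htp1⟩
  have hSm : S.card ≤ m := Finset.card_le_univ S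
  have hcard := card_mt hti hSt
  rw [← hm] at hcard
  have hmod : t ≤ m % p := by
    by_contra hlt
    push Not at hlt
    have h3 : p ∣ m.descFactorial t := by
      rw [Nat.descFactorial_eq_prod_range]
      exact (Nat.dvd_sub_mod m).trans
        (Finset.dvd_prod_of_mem (fun i => m - i) (Finset.mem_range.2 hlt))
    have := Nat.dvd_gcd (h3.trans (Dvd.intro _ hcard.symm)) (dvd_refl p)
    rw [hX] at this
    exact hp.one_lt.ne' (Nat.dvd_one.1 this)
  have hSne : S.Nonempty := Finset.card_pos.1 (by omega)
  have hSinv := GS_inv X S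
  have he2 := two_orb hSne hSinv (fun h => htn (mt_succ hti hSt h))
  set e := (S.image (orb (GS X S))).card with he
  set D := m.descFactorial t with hD
  set G := Nat.card (GS X S) with hG
  rw [hcard]
  have hpp : 0 < p := hp.pos
  by_cases hSμ : S.card < μ
  · have : G = 1 := hmu S hSμ
    rw [this, mul_one]
    exact numA (by omega) htp hpm
  push Not at hSμ
  by_cases hbig : ∃ a ∈ S, μ ≤ (orb (GS X S) a).card
  · obtain ⟨a, haS, haμ⟩ := hbig
    set O := orb (GS X S) a with hO
    have hOS : O ⊆ S := orb_sub hSinv haS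
    have hRinv : Inva (GS X S) (S \ O) := Inva_sdiff hSinv (orb_inv _ _)
    have hRc := Finset.card_sdiff_add_card_eq_card hOS
    have h3 := ML (p := p) (by omega) hRinv hX (fun k hk => hB k (by omega))
    rw [Finset.sdiff_sdiff_eq_self hOS] at h3
    have h4 : e - 1 ≤ ((S \ O).image (orb (GS X S))).card := by
      rw [he, ← Finset.card_erase_of_mem (Finset.mem_image_of_mem (orb (GS X S)) haS)]
      apply Finset.card_le_card
      intro Q hQ
      rw [Finset.mem_erase] at hQ
      obtain ⟨b, hbS, rfl⟩ := Finset.mem_image.1 hQ.2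
      apply Finset.mem_image_of_mem
      rw [Finset.mem_sdiff]
      exact ⟨hbS, fun hbO => hQ.1 (orb_eq hbO)⟩
    have h5 := claimG hp3 hX hB hprim htn (by omega) hμ hmu O.card O rfl (by omega) haμ
    have h6 := numB hp' ht2 htp hmod he2 hSp hμ hb
    set w := (μ - 1) / 2
    have h7 : G * p ^ (e - 1) ≤ p ^ (S \ O).card * Nat.card (GS X O) :=
      (Nat.mul_le_mul_left _ (Nat.pow_le_pow_right hpp h4)).trans h3
    have h8 : G * p ^ (e + w + 2) ≤ (p + 1) * p ^ S.card := by
      calc G * p ^ (e + w + 2) = (G * p ^ (e - 1)) * p ^ (w + 3) := by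
            rw [mul_assoc, ← pow_add]; congr 2; omega
        _ ≤ (p ^ (S \ O).card * Nat.card (GS X O)) * p ^ (w + 3) := Nat.mul_le_mul_right _ h7
        _ = p ^ (S \ O).card * (Nat.card (GS X O) * p ^ (w + 3)) := by ring
        _ ≤ p ^ (S \ O).card * ((p + 1) * p ^ O.card) := Nat.mul_le_mul_left _ h5
        _ = (p + 1) * p ^ ((S \ O).card + O.card) := by rw [pow_add]; ring
        _ = _ := by rw [hRc]
    have h9 : (D * G) * ((p + 1) * p ^ (e + w + 2)) ≤
        (2 * p ^ (m - 2)) * ((p + 1) * p ^ (e + w + 2)) := by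
      calc (D * G) * ((p + 1) * p ^ (e + w + 2)) = ((p + 1) * D) * (G * p ^ (e + w + 2)) := by ring
        _ ≤ (2 * p ^ (t + e + w)) * ((p + 1) * p ^ S.card) := Nat.mul_le_mul h6 h8
        _ = 2 * (p + 1) * p ^ ((t + e + w) + S.card) := by rw [pow_add _ (t + e + w)]; ring
        _ = 2 * (p + 1) * p ^ ((m - 2) + (e + w + 2)) := by congr 2; omega
        _ = _ := by rw [pow_add _ (m - 2)]; ring
    exact Nat.le_of_mul_le_mul_right h9 (by positivity)
  · push Not at hbig
    obtain ⟨U, hUS, hUinv, hUμ, hU2⟩ := maxInv hSinv hSμ (by omega) hbig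
    have hRinv : Inva (GS X S) (S \ U) := Inva_sdiff hSinv hUinv
    have hRc := Finset.card_sdiff_add_card_eq_card hUS
    have h3 := ML (p := p) (by omega) hRinv hX (fun k hk => hB k (by omega))
    rw [Finset.sdiff_sdiff_eq_self hUS, hmu U hUμ, mul_one] at h3
    have h4 := sum_orb hRinv
    set e' := ((S \ U).image (orb (GS X S))).card with he'
    have h5 : (S \ U).card ≤ e' * (μ - 1) := by
      rw [← h4, he', ← smul_eq_mul]
      apply Finset.sum_le_card_nsmul
      intro O hO
      obtain ⟨b, hbS, rfl⟩ := Finset.mem_image.1 hO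
      have := hbig b (Finset.mem_sdiff.1 hbS).1
      omega
    have h6 : 1 ≤ e' := by
      rw [he', Nat.one_le_iff_ne_zero, Finset.card_ne_zero, Finset.image_nonempty,
        ← Finset.card_pos]
      omega
    have h7 := numC hp' ht2 htp hmod hμ hpm hb hUμ hU2 h6 (by omega)
    have h9 : (D * G) * p ^ e' ≤ (2 * p ^ (m - 2)) * p ^ e' := by
      calc (D * G) * p ^ e' = D * (G * p ^ e') := by ring
        _ ≤ (2 * p ^ (t + U.card + e' - 2)) * p ^ (S \ U).card := Nat.mul_le_mul h7 h3
        _ = 2 * p ^ ((t + U.card + e' - 2) + (S \ U).card) := by rw [pow_add]; ring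
        _ = 2 * p ^ ((m - 2) + e') := by congr 2; omega
        _ = _ := by rw [pow_add]; ring
    exact Nat.le_of_mul_le_mul_right h9 (by positivity)

theorem case_two {p : ℕ} (hp : p.Prime) {X : Subgroup (Perm α)}
    (hX : Nat.Coprime (Nat.card X) p) (hB : ∀ k < Fintype.card α, Bd p k)
    (hprim : IsPreprimitive X α) (h2 : IsMultiplyPretransitive X α 2)
    (hm2 : 2 ≤ Fintype.card α) :
    Nat.card X ≤ 2 * p ^ (Fintype.card α - 2) := by
  have hndvd : ¬ p ∣ Nat.card X := by
    intro h
    have := Nat.dvd_gcd h (dvd_refl p)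
    rw [hX] at this
    exact hp.one_lt.ne' (Nat.dvd_one.1 this)
  by_cases hpm : p ≤ Fintype.card α
  swap
  · obtain ⟨k, hk⟩ : ∃ k, Fintype.card α = k + 2 := ⟨Fintype.card α - 2, by omega⟩
    have h1 : Nat.card X ≤ (Fintype.card α).factorial := by
      rw [← Fintype.card_perm, ← Nat.card_eq_fintype_card]
      exact Subgroup.card_le_card_group X
    rw [hk] at h1 ⊢
    refine h1.trans ((fact_bound k).trans ?_)
    rw [Nat.add_sub_cancel]
    exact Nat.mul_le_mul_left _ (Nat.pow_le_pow_left (by omega) _)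
  by_cases hXb : X = ⊥
  · rw [hXb]
    have := Nat.pow_pos (n := Fintype.card α - 2) hp.pos
    simp only [Subgroup.card_bot]; omega
  have hp3 : 3 ≤ p := by
    have := hp.two_le
    by_contra hlt
    have hpe : p = 2 := by omega
    exact not_p_trans hp hX hpm (by rw [hpe]; exact h2)
  have hpfact : p ∣ (Fintype.card α).factorial := Nat.dvd_factorial hp.pos hpm
  obtain ⟨g0, hg0X, hg01⟩ := (Subgroup.ne_bot_iff_exists_ne_one.1 hXb : ∃ a : X, a ≠ 1).elim
    (fun a ha => (⟨a.1, a.2, fun h => ha (Subtype.ext h)⟩ : ∃ g ∈ X, g ≠ 1))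
  classical
  obtain ⟨g, hgF, hgmin⟩ := Finset.exists_min_image
    (Finset.univ.filter (fun g : Perm α => g ∈ X ∧ g ≠ 1)) (fun g => g.support.card)
    ⟨g0, by simp [hg0X, hg01]⟩
  simp only [Finset.mem_filter, Finset.mem_univ, true_and] at hgF hgmin
  have hmin : ∀ h ∈ X, h ≠ 1 → g.support.card ≤ h.support.card := fun h h1 h2 => hgmin h ⟨h1, h2⟩
  have hb := bochert h2 hgF.1 hgF.2 hmin
  have hμm : g.support.card ≤ Fintype.card α := Finset.card_le_univ _
  have hμ : 4 ≤ g.support.card := by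
    have h3 := Perm.two_le_card_support_of_ne_one hgF.2
    by_contra hlt
    have h4 : g.support.card = 2 ∨ g.support.card = 3 := by omega
    rcases h4 with h4 | h4
    · have := Equiv.Perm.subgroup_eq_top_of_isPreprimitive_of_isSwap_mem hprim g
        (Perm.card_support_eq_two.1 h4) hgF.1
      apply hndvd
      rw [this, Subgroup.card_top, Nat.card_eq_fintype_card, Fintype.card_perm]
      exact hpfact
    · have h5 := Equiv.Perm.alternatingGroup_le_of_isPreprimitive_of_isThreeCycle_mem hprim
        (card_support_eq_three_iff.1 h4) hgF.1
      have h6 := Subgroup.card_dvd_of_le h5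
      have : Nontrivial α := Fintype.one_lt_card_iff_nontrivial.1 (by omega)
      have h7 := two_mul_nat_card_alternatingGroup (α := α)
      rw [Nat.card_eq_fintype_card (α := Perm α), Fintype.card_perm] at h7
      rw [← h7] at hpfact
      rcases hp.dvd_mul.1 hpfact with h8 | h8
      · have := Nat.le_of_dvd (by norm_num) h8; omega
      · exact hndvd (h8.trans h6)
  by_cases h11 : 11 ≤ p
  · exact case_big h11 hX hB hμ hμm hmin hb
  · have hp' : p = 3 ∨ p = 5 ∨ p = 7 := by
      push Not at h11
      interval_cases p <;> first | omega | (exfalso; revert hp; decide)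
    exact case_small hp' hp hX hB hprim h2 hpm hμ hmin hb

end Two

theorem Bd_all {p : ℕ} (hp : p.Prime) (n : ℕ) : Bd p n := by
  induction n using Nat.strong_induction_on with
  | _ n ih =>
  intro α _ X hn hX
  classical
  have hp2 := hp.two_le
  subst hn
  by_cases h1 : Fintype.card α ≤ 1
  · have : Subsingleton α := Fintype.card_le_one_iff_subsingleton.1 h1
    have h3 : Nat.card X ≤ 1 := Finite.card_le_one_iff_subsingleton.2 inferInstance
    exact h3.trans (FF_pos hp2 _)
  by_cases htr : TransOn X Finset.univ
  swap
  · exact case_intrans hp2 hX ih htr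
  by_cases hb : ∃ B, Blk X B ∧ 1 < B.card ∧ B ≠ Finset.univ
  · obtain ⟨B, hB, hB1, hB2⟩ := hb
    exact case_imprim hp2 hX ih htr hB hB1 hB2
  have hprim : MulAction.IsPreprimitive X α := link_prim_top htr (by
    intro B hB
    by_contra hc
    push Not at hc
    exact hb ⟨B, hB, hc.1, hc.2⟩)
  by_cases h2 : MulAction.IsMultiplyPretransitive X α 2
  · rw [FF_two (by omega)]
    exact case_two hp hX ih hprim h2 (by omega)
  · exact case_prim hp2 hX ih hprim h2 (by omega)

theorem stmt_6 (p m : ℕ) (hp : p.Prime) (X : Subgroup (Equiv.Perm (Fin m))) (hX : Nat.Coprime (Nat.card X) p) (hm : 1 < m) : Nat.card X < p ^ (m - 1) := by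
  have h := Bd_all hp m (Fin m) X (Fintype.card_fin m) hX
  rw [FF_two hm] at h
  obtain ⟨k, rfl⟩ : ∃ k, m = k + 2 := ⟨m - 2, by omega⟩
  rw [Nat.add_sub_cancel] at h
  have e : k + 2 - 1 = k + 1 := by omega
  rw [e, pow_succ']
  have hpos := Nat.pow_pos (n := k) hp.pos
  rcases eq_or_lt_of_le hp.two_le with h2 | h2
  · subst h2
    refine lt_of_le_of_ne h (fun heq => ?_)
    rw [heq] at hX
    have := Nat.dvd_gcd (Dvd.intro (2 ^ k) rfl : 2 ∣ 2 * 2 ^ k) (dvd_refl 2)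
    rw [hX] at this
    norm_num at this
  · exact lt_of_le_of_lt h (Nat.mul_lt_mul_of_pos_right h2 hpos)
end

section
/- Let G be a finite group, N a normal subgroup, χ an irreducible complex character of G and θ an irreducible constituent of the restriction of χ to N. Then χ(1)/θ(1) divides the index |G : N| (as integers, i.e. θ(1) divides χ(1) and the quotient divides |G:N|); consequently, if |G:N| is coprime to a prime p, then p ∤ χ(1) if and only if p ∤ θ(1). -/
open CategoryTheory Module

namespace Stmt15

/-- Irreducibility via invariant subspaces. -/
def Irr {G V : Type} [Group G] [AddCommGroup V] [Module ℂ V] (ρ : G →* (V →ₗ[ℂ] V)) : Prop :=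
  Nontrivial V ∧ ∀ U : Submodule ℂ V, (∀ g, ∀ v ∈ U, ρ g v ∈ U) → U = ⊥ ∨ U = ⊤

theorem irr_of_simple {G : Type} [Group G] (V : FDRep ℂ G) (hV : Simple V) : Irr V.ρ := by
  refine ⟨?_, ?_⟩
  · by_contra h
    rw [not_nontrivial_iff_subsingleton] at h
    apply id_nonzero V
    ext x
    exact Subsingleton.elim (α := V) _ _
  · intro U hU
    by_cases hb : U = ⊥
    · exact Or.inl hb
    right
    let r : Representation ℂ G U :=
      { toFun := fun g => (V.ρ g).restrict (hU g)
        map_one' := by ext; simp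
        map_mul' := fun a b => by ext; simp }
    let i : FDRep.of r ⟶ V := ⟨InducedCategory.homMk (ModuleCat.ofHom U.subtype), fun g => by
      ext1
      rfl⟩
    have hinj : Function.Injective (fun x : U => (i.hom.hom.hom : U →ₗ[ℂ] V) x) :=
      Subtype.val_injective
    have : Mono i := ConcreteCategory.mono_of_injective i hinj
    have hne : i ≠ 0 := by
      intro h0
      apply hb
      rw [eq_bot_iff]
      intro x hx
      have : (i.hom.hom.hom : U →ₗ[ℂ] V) ⟨x, hx⟩ = 0 := by rw [h0]; rfl
      exact this
    have hi : IsIso i := isIso_of_mono_of_nonzero hne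
    rw [eq_top_iff]
    intro x _
    have h1 : (i.hom.hom.hom : U →ₗ[ℂ] V) (((inv i).hom.hom.hom : V →ₗ[ℂ] U) x) = x := by
      have := IsIso.inv_hom_id i
      have h2 := congrArg (fun j : V ⟶ V => (j.hom.hom.hom : V →ₗ[ℂ] V) x) this
      exact h2
    rw [← h1]
    exact (((inv i).hom.hom.hom : V →ₗ[ℂ] U) x).2

variable {G V W : Type} [Group G] [AddCommGroup V] [Module ℂ V] [FiniteDimensional ℂ V]
  [AddCommGroup W] [Module ℂ W] [FiniteDimensional ℂ W]

theorem schur {ρ : G →* (V →ₗ[ℂ] V)} (h : Irr ρ) (X : V →ₗ[ℂ] V)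
    (hX : ∀ g, X * ρ g = ρ g * X) : ∃ c : ℂ, X = c • 1 := by
  obtain ⟨hn, hs⟩ := h
  obtain ⟨c, hc⟩ := Module.End.exists_eigenvalue X
  refine ⟨c, ?_⟩
  rcases hs (Module.End.eigenspace X c) (by
    intro g v hv
    rw [Module.End.mem_eigenspace_iff] at hv ⊢
    have := LinearMap.congr_fun (hX g) v
    simp only [Module.End.mul_apply] at this
    rw [this, hv, map_smul]) with h | h
  · exact absurd h hc
  · ext v
    have : v ∈ Module.End.eigenspace X c := by rw [h]; trivial
    rw [Module.End.mem_eigenspace_iff] at this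
    simpa using this

theorem sum_comp' {ι U : Type} [Fintype ι] [AddCommGroup U] [Module ℂ U] (F : ι → (V →ₗ[ℂ] W))
    (g : U →ₗ[ℂ] V) : (∑ i, F i) ∘ₗ g = ∑ i, F i ∘ₗ g := by
  ext; simp

theorem comp_sum' {ι U : Type} [Fintype ι] [AddCommGroup U] [Module ℂ U] (F : ι → (V →ₗ[ℂ] W))
    (g : W →ₗ[ℂ] U) : g ∘ₗ (∑ i, F i) = ∑ i, g ∘ₗ F i := by
  ext; simp

theorem exists_hom [Fintype G] (ρ : G →* (V →ₗ[ℂ] V)) (σ : G →* (W →ₗ[ℂ] W)) (hσ : Irr σ)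
    (h : ∑ n, LinearMap.trace ℂ V (ρ n) * LinearMap.trace ℂ W (σ n⁻¹) ≠ 0) :
    ∃ (f : W →ₗ[ℂ] V) (φ : V →ₗ[ℂ] W), (∀ n, f ∘ₗ σ n = ρ n ∘ₗ f) ∧ (∀ n, φ ∘ₗ ρ n = σ n ∘ₗ φ)
      ∧ φ ∘ₗ f = LinearMap.id := by
  have hcard : (Nat.card G : ℂ) ≠ 0 := by simp
  let _ : Invertible (Nat.card G : ℂ) := invertibleOfNonzero hcard
  have key := Representation.card_inv_mul_sum_char_mul_char_eq_finrank
    (ρ := (σ : Representation ℂ G W)) (σ := (ρ : Representation ℂ G V))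
  have h0 : (finrank ℂ (Representation.IntertwiningMap (σ : Representation ℂ G W)
      (ρ : Representation ℂ G V)) : ℂ) ≠ 0 := by
    rw [← key]
    exact mul_ne_zero (inv_ne_zero hcard) h
  have h1 : Nontrivial (Representation.IntertwiningMap (σ : Representation ℂ G W)
      (ρ : Representation ℂ G V)) := by
    by_contra hh
    rw [not_nontrivial_iff_subsingleton] at hh
    exact h0 (by simp [Module.finrank_zero_of_subsingleton])
  obtain ⟨F, hF⟩ := exists_ne (0 : Representation.IntertwiningMap (σ : Representation ℂ G W)
      (ρ : Representation ℂ G V))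
  let f : W →ₗ[ℂ] V := F.toLinearMap
  have hf : ∀ n, f ∘ₗ σ n = ρ n ∘ₗ f := F.isIntertwining'
  have hf0 : f ≠ 0 := by
    intro hh; apply hF; ext x; exact LinearMap.congr_fun hh x
  have hker : LinearMap.ker f = ⊥ := by
    rcases hσ.2 (LinearMap.ker f) (by
      intro g v hv
      rw [LinearMap.mem_ker] at hv ⊢
      have := LinearMap.congr_fun (hf g) v
      simp only [LinearMap.comp_apply] at this
      rw [this, hv, map_zero]) with h | h
    · exact h
    · exact absurd (LinearMap.ker_eq_top.1 h) hf0
  obtain ⟨π, hπ⟩ := LinearMap.exists_leftInverse_of_injective f hker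
  refine ⟨f, (Nat.card G : ℂ)⁻¹ • ∑ n, σ n ∘ₗ π ∘ₗ ρ n⁻¹, hf, ?_, ?_⟩
  · intro m
    rw [LinearMap.smul_comp, LinearMap.comp_smul, sum_comp', comp_sum']
    congr 1
    refine Fintype.sum_equiv (Equiv.mulLeft m⁻¹) _ _ ?_
    intro n
    ext v
    simp only [LinearMap.comp_apply, Equiv.coe_mulLeft, mul_inv_rev, inv_inv, map_mul,
      Module.End.mul_apply]
    rw [← Module.End.mul_apply (σ m), ← map_mul, mul_inv_cancel]
    simp
  · rw [LinearMap.smul_comp, sum_comp']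
    have : ∀ n, (σ n ∘ₗ π ∘ₗ ρ n⁻¹) ∘ₗ f = LinearMap.id := by
      intro n
      rw [LinearMap.comp_assoc, LinearMap.comp_assoc, ← hf, ← LinearMap.comp_assoc _ f π, hπ,
        LinearMap.id_comp]
      change σ n * σ n⁻¹ = 1
      rw [← map_mul]; simp
    simp only [this]
    rw [Finset.sum_const, ← Nat.cast_smul_eq_nsmul ℂ, smul_smul, Finset.card_univ,
      ← Nat.card_eq_fintype_card, inv_mul_cancel₀ hcard, one_smul]

/-- Dimension divisibility. -/
theorem dim_dvd (N : Subgroup G) [N.Normal] {ρ : G →* (V →ₗ[ℂ] V)} {σ : N →* (W →ₗ[ℂ] W)}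
    (hρ : Irr ρ) (hσ : Irr σ) (f : W →ₗ[ℂ] V) (hf : ∀ n : N, f ∘ₗ σ n = ρ n ∘ₗ f)
    (hinj : Function.Injective f) : finrank ℂ W ∣ finrank ℂ V := by
  have hf' : ∀ (n : N) w, f (σ n w) = ρ n (f w) := fun n w => LinearMap.congr_fun (hf n) w
  have hρinj : ∀ g, Function.Injective (ρ g) := by
    intro g x y hxy
    have := congrArg (ρ g⁻¹) hxy
    rw [← Module.End.mul_apply, ← Module.End.mul_apply, ← map_mul] at this
    simpa using this
  let S : Set (Submodule ℂ V) := {U | (∀ n : N, ∀ v ∈ U, ρ n v ∈ U) ∧ finrank ℂ W ∣ finrank ℂ U}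
  have hS : S.Nonempty := ⟨⊥, by simp +contextual [S]⟩
  obtain ⟨U, ⟨hU1, hU2⟩, hmax⟩ := WellFounded.has_min
    (wellFounded_gt : WellFounded ((· > ·) : Submodule ℂ V → Submodule ℂ V → Prop)) S hS
  -- all translates lie in `U`
  have hall : ∀ g w, ρ g (f w) ∈ U := by
    intro g
    by_contra hcon
    let e : W →ₗ[ℂ] V := ρ g ∘ₗ f
    have he : Function.Injective e := (hρinj g).comp hinj
    have hen : ∀ (n : N) w, ρ n (e w) = e (σ ⟨g⁻¹ * n * g, by
        simpa using (inferInstance : N.Normal).conj_mem n n.2 g⁻¹⟩ w) := by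
      intro n w
      simp only [e, LinearMap.comp_apply, hf', ← Module.End.mul_apply, ← map_mul]
      congr 2; group
    have hen' : ∀ (n : N) w, e (σ n w) = ρ (g * n * g⁻¹) (e w) := by
      intro n w
      simp only [e, LinearMap.comp_apply, hf', ← Module.End.mul_apply, ← map_mul]
      congr 2; group
    have hdisj : U ⊓ LinearMap.range e = ⊥ := by
      rcases hσ.2 (U.comap e) (by
        intro n v hv
        rw [Submodule.mem_comap] at hv ⊢
        rw [hen']
        exact hU1 ⟨_, (inferInstance : N.Normal).conj_mem n n.2 g⟩ _ hv) with h | h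
      · rw [eq_bot_iff]
        rintro _ ⟨hx, w, rfl⟩
        have : w ∈ U.comap e := hx
        rw [h, Submodule.mem_bot] at this
        simp [this]
      · exfalso; apply hcon
        intro w
        have : w ∈ U.comap e := by rw [h]; trivial
        exact this
    refine hmax (U ⊔ LinearMap.range e) ⟨?_, ?_⟩ ?_
    · intro n v hv
      obtain ⟨a, ha, b, ⟨w, rfl⟩, rfl⟩ := Submodule.mem_sup.1 hv
      rw [map_add, hen]
      exact Submodule.add_mem_sup (hU1 n a ha) ⟨_, rfl⟩
    · have h1 := Submodule.finrank_sup_add_finrank_inf_eq U (LinearMap.range e)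
      rw [hdisj, finrank_bot, add_zero, LinearMap.finrank_range_of_inj he] at h1
      rw [h1]
      exact dvd_add hU2 dvd_rfl
    · refine lt_of_le_of_ne le_sup_left ?_
      intro heq
      apply hcon
      intro w
      rw [heq]
      exact Submodule.mem_sup_right ⟨w, rfl⟩
  let T : Submodule ℂ V := ⨅ g, U.comap (ρ g)
  have hT : ∀ v, v ∈ T ↔ ∀ g, ρ g v ∈ U := by intro v; simp [T]
  have : T = ⊤ := by
    rcases hρ.2 T (by
      intro g v hv
      rw [hT] at hv ⊢
      intro g'
      rw [← Module.End.mul_apply, ← map_mul]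
      exact hv _) with h | h
    · exfalso
      have := hσ.1
      obtain ⟨w, hw⟩ := exists_ne (0 : W)
      have : f w ∈ T := (hT _).2 fun g => hall g w
      rw [h, Submodule.mem_bot] at this
      exact hw (hinj (by simpa using this))
    · exact h
  have hUt : U = ⊤ := by
    rw [eq_top_iff]
    intro v _
    have hv : v ∈ T := by rw [this]; trivial
    simpa using (hT v).1 hv 1
  rw [hUt, finrank_top] at hU2
  exact hU2

theorem casimir [Fintype G] {ρ : G →* (V →ₗ[ℂ] V)} (hρ : Irr ρ) (Y : V →ₗ[ℂ] V) :
    ∑ g, ρ g * Y * ρ g⁻¹ = ((Nat.card G : ℂ) / finrank ℂ V * LinearMap.trace ℂ V Y) • 1 := by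
  have := hρ.1
  obtain ⟨c, hc⟩ := schur hρ (∑ g, ρ g * Y * ρ g⁻¹) (by
    intro h
    rw [Finset.sum_mul, Finset.mul_sum]
    refine Fintype.sum_equiv (Equiv.mulLeft h⁻¹) _ _ ?_
    intro g
    simp only [Equiv.coe_mulLeft, mul_inv_rev, inv_inv, map_mul]
    have h1 : ρ h * ρ h⁻¹ = 1 := by rw [← map_mul]; simp
    simp only [← mul_assoc, h1, one_mul])
  have ht := congrArg (LinearMap.trace ℂ V) hc
  have hd : (finrank ℂ V : ℂ) ≠ 0 := by
    exact_mod_cast (Module.finrank_pos (R := ℂ) (M := V)).ne'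
  rw [map_sum] at ht
  have h2 : ∀ g, LinearMap.trace ℂ V (ρ g * Y * ρ g⁻¹) = LinearMap.trace ℂ V Y := by
    intro g
    rw [LinearMap.trace_mul_comm, ← mul_assoc, ← map_mul]
    simp
  simp only [h2, Finset.sum_const, map_smul, LinearMap.trace_one, nsmul_eq_mul, smul_eq_mul,
    Finset.card_univ, ← Nat.card_eq_fintype_card] at ht
  rw [hc]
  congr 1
  field_simp
  exact ht.symm

section main

variable {N : Subgroup G} [N.Normal]

/-- `A` intertwines `σ` with its conjugate by `g`. -/
def Tw (σ : N →* (W →ₗ[ℂ] W)) (g : G) (A : W →ₗ[ℂ] W) : Prop :=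
  ∀ n : N, A * σ n = σ (MulAut.conjNormal g n) * A

theorem Tw.mul {σ : N →* (W →ₗ[ℂ] W)} {g h : G} {A B : W →ₗ[ℂ] W} (hA : Tw σ g A)
    (hB : Tw σ h B) : Tw σ (g * h) (A * B) := by
  intro n
  rw [mul_assoc, hB, ← mul_assoc, hA, mul_assoc, map_mul]; rfl

theorem Tw.inv {σ : N →* (W →ₗ[ℂ] W)} {g : G} {A : (W →ₗ[ℂ] W)ˣ} (hA : Tw σ g A) :
    Tw σ g⁻¹ (A⁻¹ : (W →ₗ[ℂ] W)ˣ) := by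
  intro n
  have h := hA (MulAut.conjNormal g⁻¹ n)
  have h2 : MulAut.conjNormal g (MulAut.conjNormal g⁻¹ n) = n := by
    rw [← MulAut.mul_apply, ← map_mul]; simp
  rw [h2] at h
  rw [Units.inv_mul_eq_iff_eq_mul, ← mul_assoc, h, mul_assoc]
  simp

theorem Tw.smul {σ : N →* (W →ₗ[ℂ] W)} {g : G} {A : W →ₗ[ℂ] W} (hA : Tw σ g A) (s : ℂ) :
    Tw σ g (s • A) := by
  intro n
  rw [smul_mul_assoc, hA, mul_smul_comm]

theorem tw_coeff {ρ : G →* (V →ₗ[ℂ] V)} {σ : N →* (W →ₗ[ℂ] W)} {f : W →ₗ[ℂ] V} {φ : V →ₗ[ℂ] W}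
    (hf : ∀ n : N, f ∘ₗ σ n = ρ n ∘ₗ f) (hφ : ∀ n : N, φ ∘ₗ ρ n = σ n ∘ₗ φ) (g : G) :
    Tw σ g (φ ∘ₗ ρ g ∘ₗ f) := by
  intro n
  ext w
  have hf' : ∀ (n : N) w, f (σ n w) = ρ n (f w) := fun n w => LinearMap.congr_fun (hf n) w
  have hφ' : ∀ (n : N) w, σ n (φ w) = φ (ρ n w) := fun n w => (LinearMap.congr_fun (hφ n) w).symm
  simp only [Module.End.mul_apply, LinearMap.comp_apply, hf', hφ', MulAut.conjNormal_apply]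
  simp only [← Module.End.mul_apply, ← map_mul]
  congr 3
  group

theorem tw_zero_or {σ : N →* (W →ₗ[ℂ] W)} (hσ : Irr σ) {g : G} {Z : W →ₗ[ℂ] W}
    (hZ : Tw σ g Z) (h0 : Z ≠ 0) : LinearMap.det Z ≠ 0 := by
  have hker : LinearMap.ker Z = ⊥ := by
    rcases hσ.2 (LinearMap.ker Z) (by
      intro n v hv
      rw [LinearMap.mem_ker] at hv ⊢
      have := LinearMap.congr_fun (hZ n) v
      simp only [Module.End.mul_apply] at this
      rw [this, hv, map_zero]) with h | h
    · exact h
    · exact absurd (LinearMap.ker_eq_top.1 h) h0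
  intro hd
  exact (LinearMap.bot_lt_ker_of_det_eq_zero hd).ne' hker

/-- Normalised matrix coefficients. -/
def Coef (ρ : G →* (V →ₗ[ℂ] V)) (σ : N →* (W →ₗ[ℂ] W)) (f : W →ₗ[ℂ] V) (φ : V →ₗ[ℂ] W) (g : G)
    (c : ℂ) : Prop :=
  ∃ A : (W →ₗ[ℂ] W)ˣ, LinearMap.det (A : W →ₗ[ℂ] W) = 1 ∧ Tw σ g A ∧
    φ ∘ₗ ρ g ∘ₗ f = c • (A : W →ₗ[ℂ] W)

theorem coef_finite {ρ : G →* (V →ₗ[ℂ] V)} {σ : N →* (W →ₗ[ℂ] W)} (hσ : Irr σ) (f : W →ₗ[ℂ] V)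
    (φ : V →ₗ[ℂ] W) (g : G) : {c | Coef ρ σ f φ g c}.Finite := by
  have := hσ.1
  have hd : 0 < finrank ℂ W := Module.finrank_pos
  by_cases hne : ∃ c0, Coef ρ σ f φ g c0
  · obtain ⟨c0, A0, hdet0, htw0, h0⟩ := hne
    have hfin : {z : ℂ | z ^ finrank ℂ W = 1}.Finite := by
      refine (Polynomial.nthRoots (finrank ℂ W) (1 : ℂ)).toFinset.finite_toSet.subset ?_
      intro z hz
      simpa [Polynomial.mem_nthRoots hd] using hz
    refine (hfin.image (fun z => z * c0)).subset ?_
    rintro c ⟨A, hdet, htw, h⟩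
    obtain ⟨z, hz⟩ := schur hσ ((A⁻¹ : (W →ₗ[ℂ] W)ˣ) * (A0 : W →ₗ[ℂ] W)) (by
      intro n
      have := htw.inv.mul htw0 n
      simpa using this)
    have hA0 : (A0 : W →ₗ[ℂ] W) = z • (A : W →ₗ[ℂ] W) := by
      rw [Units.inv_mul_eq_iff_eq_mul] at hz
      rw [hz]; simp
    refine ⟨z, ?_, ?_⟩
    · have := congrArg LinearMap.det hA0
      rw [LinearMap.det_smul, hdet, hdet0, mul_one] at this
      exact this.symm
    · rw [h0, hA0, smul_smul] at h
      have hA : (A : W →ₗ[ℂ] W) ≠ 0 := A.ne_zero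
      change z * c0 = c
      rw [mul_comm]
      exact smul_left_injective ℂ hA h
  · have : {c | Coef ρ σ f φ g c} = ∅ := by
      ext c; simp only [Set.mem_ofPred_eq, Set.mem_empty_iff_false, iff_false]
      exact fun h => hne ⟨c, h⟩
    rw [this]; exact Set.finite_empty

theorem coef_term {ρ : G →* (V →ₗ[ℂ] V)} {σ : N →* (W →ₗ[ℂ] W)} (hσ : Irr σ) {f : W →ₗ[ℂ] V}
    {φ : V →ₗ[ℂ] W} (hf : ∀ n : N, f ∘ₗ σ n = ρ n ∘ₗ f) (hφ : ∀ n : N, φ ∘ₗ ρ n = σ n ∘ₗ φ)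
    {g1 g2 : G} {A1 A2 : (W →ₗ[ℂ] W)ˣ} (hdet1 : LinearMap.det (A1 : W →ₗ[ℂ] W) = 1)
    (hdet2 : LinearMap.det (A2 : W →ₗ[ℂ] W) = 1) (htw1 : Tw σ g1 A1) (htw2 : Tw σ g2 A2) (g : G) :
    ∃ x : ℂ, (x = 0 ∨ ∃ h k s t, Coef ρ σ f φ h s ∧ Coef ρ σ f φ k t ∧ x = s * t) ∧
      (φ ∘ₗ ρ (g * g1) ∘ₗ f) * (A1⁻¹ : (W →ₗ[ℂ] W)ˣ) *
      ((φ ∘ₗ ρ (g⁻¹ * g2) ∘ₗ f) * (A2⁻¹ : (W →ₗ[ℂ] W)ˣ)) = x • (1 : W →ₗ[ℂ] W) := by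
  have := hσ.1
  have hd : 0 < finrank ℂ W := Module.finrank_pos
  set Z : W →ₗ[ℂ] W := (φ ∘ₗ ρ (g * g1) ∘ₗ f) * (A1⁻¹ : (W →ₗ[ℂ] W)ˣ) with hZ
  have hZ' : φ ∘ₗ ρ (g * g1) ∘ₗ f = Z * A1 := by rw [hZ, mul_assoc]; simp
  set Y : W →ₗ[ℂ] W := (φ ∘ₗ ρ (g⁻¹ * g2) ∘ₗ f) * (A2⁻¹ : (W →ₗ[ℂ] W)ˣ) with hY
  have hY' : φ ∘ₗ ρ (g⁻¹ * g2) ∘ₗ f = Y * A2 := by rw [hY, mul_assoc]; simp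
  have hZt : Tw σ g Z := by
    have := (tw_coeff hf hφ (g * g1)).mul htw1.inv
    rwa [mul_inv_cancel_right] at this
  have hYt : Tw σ g⁻¹ Y := by
    have := (tw_coeff hf hφ (g⁻¹ * g2)).mul htw2.inv
    rwa [mul_inv_cancel_right] at this
  by_cases h0 : Z = 0
  · exact ⟨0, Or.inl rfl, by rw [h0]; simp⟩
  have hdz := tw_zero_or hσ hZt h0
  obtain ⟨s, hs⟩ := IsAlgClosed.exists_pow_nat_eq (LinearMap.det Z) hd
  have hs0 : s ≠ 0 := by
    rintro rfl
    rw [zero_pow hd.ne'] at hs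
    exact hdz hs.symm
  have hdA : LinearMap.det (s⁻¹ • Z) = 1 := by
    rw [LinearMap.det_smul, ← hs, ← mul_pow, inv_mul_cancel₀ hs0, one_pow]
  have hu : IsUnit (s⁻¹ • Z) := by
    rw [LinearMap.isUnit_iff_isUnit_det, hdA]; exact isUnit_one
  obtain ⟨A, hA⟩ := hu
  have hZA : Z = s • (A : W →ₗ[ℂ] W) := by rw [hA, smul_smul, mul_inv_cancel₀ hs0, one_smul]
  have hAt : Tw σ g A := by rw [hA]; exact hZt.smul _
  have hAd : LinearMap.det (A : W →ₗ[ℂ] W) = 1 := by rw [hA]; exact hdA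
  obtain ⟨t, ht⟩ := schur hσ ((A : W →ₗ[ℂ] W) * Y) (by
    intro n
    have := hAt.mul hYt n
    simpa using this)
  have hAinv : LinearMap.det ((A⁻¹ : (W →ₗ[ℂ] W)ˣ) : W →ₗ[ℂ] W) = 1 := by
    have h1 : LinearMap.det ((A : W →ₗ[ℂ] W) * ((A⁻¹ : (W →ₗ[ℂ] W)ˣ) : W →ₗ[ℂ] W)) = 1 := by
      rw [Units.mul_inv, map_one]
    rwa [map_mul, hAd, one_mul] at h1
  have hYA : Y = t • ((A⁻¹ : (W →ₗ[ℂ] W)ˣ) : W →ₗ[ℂ] W) := by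
    have : Y = (A⁻¹ : (W →ₗ[ℂ] W)ˣ) * ((A : W →ₗ[ℂ] W) * Y) := by simp
    rw [this, ht]; simp
  refine ⟨s * t, Or.inr ⟨g * g1, g⁻¹ * g2, s, t, ⟨A * A1, ?_, ?_, ?_⟩,
    ⟨A⁻¹ * A2, ?_, ?_, ?_⟩, rfl⟩, ?_⟩
  · rw [Units.val_mul, map_mul, hAd, hdet1, one_mul]
  · exact hAt.mul htw1
  · rw [hZ', hZA, Units.val_mul, smul_mul_assoc]
  · rw [Units.val_mul, map_mul, hAinv, hdet2, one_mul]
  · exact hAt.inv.mul htw2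
  · rw [hY', hYA, Units.val_mul, smul_mul_assoc]
  · rw [hZA, smul_mul_assoc, ht, smul_smul]

theorem sum_cosets [Fintype G] [Fintype (G ⧸ N)] (x : G → ℂ)
    (hx : ∀ (g : G) (n : N), x (g * n) = x g) :
    ∑ g, x g = (Nat.card N : ℂ) * ∑ q : G ⧸ N, x q.out := by
  classical
  have : Fintype N := Fintype.ofFinite N
  have hb : Function.Bijective (fun p : (G ⧸ N) × N => p.1.out * (p.2 : G)) := by
    constructor
    · rintro ⟨q, n⟩ ⟨q', n'⟩ h
      simp only at h
      have h1 : q = q' := by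
        have := congrArg (fun g : G => (g : G ⧸ N)) h
        simpa using this
      subst h1
      simpa using h
    · intro g
      refine ⟨⟨(g : G ⧸ N), ⟨((g : G ⧸ N).out)⁻¹ * g, ?_⟩⟩, by simp⟩
      rw [← QuotientGroup.eq]; simp
  rw [← Fintype.sum_bijective _ hb (fun p => x p.1.out) x (fun p => (hx _ _).symm),
    Fintype.sum_prod_type]
  simp [Finset.mul_sum]

theorem main_integral [Fintype G] {ρ : G →* (V →ₗ[ℂ] V)} {σ : N →* (W →ₗ[ℂ] W)} (hρ : Irr ρ)
    (hσ : Irr σ) {f : W →ₗ[ℂ] V}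
    {φ : V →ₗ[ℂ] W} (hf : ∀ n : N, f ∘ₗ σ n = ρ n ∘ₗ f) (hφ : ∀ n : N, φ ∘ₗ ρ n = σ n ∘ₗ φ)
    (hφf : φ ∘ₗ f = LinearMap.id) :
    IsIntegral ℤ ((N.index : ℂ) * finrank ℂ W / finrank ℂ V) := by
  classical
  have := hσ.1
  have := hρ.1
  let _ : Fintype (G ⧸ N) := Fintype.ofFinite _
  let C : Set ℂ := ⋃ g, {c | Coef ρ σ f φ g c}
  have hC : C.Finite := Set.finite_iUnion fun g => coef_finite hσ f φ g
  let D : Set ℂ := Set.image2 (fun a b => a * b) C C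
  have hD : D.Finite := hC.image2 _ hC
  have h1C : (1 : ℂ) ∈ C := by
    refine Set.mem_iUnion.2 ⟨1, 1, by simp, ?_, by simp [hφf, Module.End.one_eq_id]⟩
    intro n; simp
  have h1D : (1 : ℂ) ∈ D := ⟨1, h1C, 1, h1C, by simp⟩
  refine isIntegral_of_smul_mem_submodule (Submodule.span ℤ D) ?_ (Submodule.fg_span hD) _ ?_
  · intro hbot
    have : (1 : ℂ) ∈ Submodule.span ℤ D := Submodule.subset_span h1D
    rw [hbot, Submodule.mem_bot] at this
    exact one_ne_zero this
  intro y hy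
  induction hy using Submodule.span_induction with
  | zero => simp
  | add a b _ _ ha hb => rw [smul_add]; exact add_mem ha hb
  | smul z a _ ha => rw [smul_comm]; exact Submodule.smul_mem _ _ ha
  | mem y hy =>
    obtain ⟨c1, hc1, c2, hc2, rfl⟩ := hy
    obtain ⟨g1, A1, hdet1, htw1, h1⟩ := Set.mem_iUnion.1 hc1
    obtain ⟨g2, A2, hdet2, htw2, h2⟩ := Set.mem_iUnion.1 hc2
    choose x hx hxe using coef_term hσ hf hφ hdet1 hdet2 htw1 htw2
    have hf' : ∀ (n : N) w, f (σ n w) = ρ n (f w) := fun n w => LinearMap.congr_fun (hf n) w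
    have hφ' : ∀ (n : N) w, φ (ρ n w) = σ n (φ w) := fun n w => LinearMap.congr_fun (hφ n) w
    let F1 : W →ₗ[ℂ] V := ρ g1 ∘ₗ f ∘ₗ (A1⁻¹ : (W →ₗ[ℂ] W)ˣ)
    let F2 : W →ₗ[ℂ] V := ρ g2 ∘ₗ f ∘ₗ (A2⁻¹ : (W →ₗ[ℂ] W)ˣ)
    have hxF : ∀ g, φ ∘ₗ ((ρ g * (F1 ∘ₗ φ) * ρ g⁻¹) ∘ₗ F2) = x g • (1 : W →ₗ[ℂ] W) := by
      intro g
      rw [← hxe g, map_mul, map_mul]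
      rfl
    have hF1 : φ ∘ₗ F1 = c1 • (1 : W →ₗ[ℂ] W) := by
      have : φ ∘ₗ F1 = (φ ∘ₗ ρ g1 ∘ₗ f) * (A1⁻¹ : (W →ₗ[ℂ] W)ˣ) := rfl
      rw [this, h1]; simp
    have hF2 : φ ∘ₗ F2 = c2 • (1 : W →ₗ[ℂ] W) := by
      have : φ ∘ₗ F2 = (φ ∘ₗ ρ g2 ∘ₗ f) * (A2⁻¹ : (W →ₗ[ℂ] W)ˣ) := rfl
      rw [this, h2]; simp
    have hone : ∀ a b : ℂ, a • (1 : W →ₗ[ℂ] W) = b • (1 : W →ₗ[ℂ] W) → a = b := fun a b h =>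
      smul_left_injective ℂ (one_ne_zero : (1 : W →ₗ[ℂ] W) ≠ 0) h
    have hF2n : ∀ (n : N) w, ρ n (F2 w) = F2 (σ n w) := by
      intro n w
      have hh := LinearMap.congr_fun (htw2.inv n) w
      simp only [Module.End.mul_apply] at hh
      simp only [F2, LinearMap.comp_apply, hh, hf', MulAut.conjNormal_apply]
      simp only [← Module.End.mul_apply, ← map_mul]
      congr 2; group
    -- left invariance
    have hxl : ∀ (g : G) (n : N), x (n * g) = x g := by
      intro g n
      apply hone
      rw [← hxF]
      have : φ ∘ₗ ((ρ (n * g) * (F1 ∘ₗ φ) * ρ (n * g)⁻¹) ∘ₗ F2) =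
          σ n * (φ ∘ₗ ((ρ g * (F1 ∘ₗ φ) * ρ g⁻¹) ∘ₗ F2)) * σ n⁻¹ := by
        ext w
        have hh := hF2n n⁻¹ w
        simp only [InvMemClass.coe_inv] at hh
        simp only [LinearMap.comp_apply, Module.End.mul_apply, map_mul, mul_inv_rev, hφ', hh]
      rw [this, hxF, mul_smul_comm, mul_one, smul_mul_assoc, ← map_mul]
      simp
    have hxr : ∀ (g : G) (n : N), x (g * n) = x g := by
      intro g n
      rw [← hxl g (MulAut.conjNormal g n)]
      congr 1
      simp
    have hsum : ∑ g, x g = (Nat.card G : ℂ) / finrank ℂ V * (c1 * finrank ℂ W) * c2 := by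
      apply hone
      rw [Finset.sum_smul]
      simp only [← hxF]
      have hcas := casimir hρ (F1 ∘ₗ φ)
      rw [LinearMap.trace_comp_comm', hF1, map_smul, LinearMap.trace_one, smul_eq_mul] at hcas
      rw [← comp_sum', ← sum_comp', hcas, LinearMap.smul_comp, LinearMap.comp_smul]
      change _ • (φ ∘ₗ F2) = _
      rw [hF2, smul_smul]
    rw [sum_cosets x hxr, ← N.index_mul_card] at hsum
    have hN : (Nat.card N : ℂ) ≠ 0 := by simp
    have hval : ((N.index : ℂ) * finrank ℂ W / finrank ℂ V) • (c1 * c2)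
        = ∑ q : G ⧸ N, x q.out := by
      apply mul_left_cancel₀ hN
      rw [hsum, smul_eq_mul]
      push_cast
      ring
    change ((N.index : ℂ) * finrank ℂ W / finrank ℂ V) • (c1 * c2) ∈ _
    rw [hval]
    refine Submodule.sum_mem _ fun q _ => ?_
    rcases hx q.out with h | ⟨h, k, s, t, hs, ht, h⟩
    · rw [h]; exact zero_mem _
    · rw [h]
      exact Submodule.subset_span ⟨s, Set.mem_iUnion.2 ⟨_, hs⟩, t, Set.mem_iUnion.2 ⟨_, ht⟩, rfl⟩

end main

end Stmt15

/-- Let `N ⊴ G`, `χ = V.character` an irreducible character of `G` and `θ = W.character` an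
irreducible character of `N` which is a constituent of the restriction of `χ` to `N` (the
inner product `[χ|_N, θ] = (1/|N|) ∑_{n} χ(n) θ(n⁻¹)` is nonzero). Then `θ(1) ∣ χ(1)` with
`χ(1)/θ(1)` dividing `|G : N|`; consequently if `p ∤ |G : N|`, then `p ∤ χ(1) ↔ p ∤ θ(1)`. -/
theorem stmt_15 (p : ℕ) (hp : p.Prime) (G : Type) [Group G] [Fintype G] [DecidableEq G]
    (N : Subgroup G) [N.Normal] [Fintype ↥N]
    (V : FDRep ℂ G) (hV : Simple V) (W : FDRep ℂ ↥N) (hW : Simple W)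
    (hconst : (∑ n : ↥N, V.character ↑n * W.character n⁻¹) ≠ 0) :
    (∃ m : ℕ, finrank ℂ W * m = finrank ℂ V ∧ m ∣ N.index) ∧
      (¬ p ∣ N.index → (¬ p ∣ finrank ℂ V ↔ ¬ p ∣ finrank ℂ W)) := by 
  have hρ := Stmt15.irr_of_simple V hV
  have hσ := Stmt15.irr_of_simple W hW
  obtain ⟨f, φ, hf, hφ, hφf⟩ := Stmt15.exists_hom (V.ρ.comp N.subtype) W.ρ hσ hconst
  have hinj : Function.Injective f := by
    intro a b hab
    have h1 := LinearMap.congr_fun hφf a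
    have h2 := LinearMap.congr_fun hφf b
    simp only [LinearMap.comp_apply, LinearMap.id_apply] at h1 h2
    rw [← h1, ← h2, hab]
  obtain ⟨m, hm⟩ := Stmt15.dim_dvd N hρ hσ f hf hinj
  have hint := Stmt15.main_integral hρ hσ hf hφ hφf
  have := hρ.1
  have := hσ.1
  have hdV : 0 < finrank ℂ V := Module.finrank_pos
  have hdW : 0 < finrank ℂ W := Module.finrank_pos
  have hmd : m ∣ N.index := by
    have hq : IsIntegral ℤ ((N.index : ℚ) * finrank ℂ W / finrank ℂ V) := by
      rw [← isIntegral_algebraMap_iff (B := ℂ) (algebraMap ℚ ℂ).injective]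
      simpa using hint
    obtain ⟨z, hz⟩ := IsIntegrallyClosed.algebraMap_eq_of_integral hq
    have hV0 : (finrank ℂ V : ℚ) ≠ 0 := by exact_mod_cast hdV.ne'
    have hW0 : (finrank ℂ W : ℚ) ≠ 0 := by exact_mod_cast hdW.ne'
    rw [eq_div_iff hV0, hm] at hz
    push_cast at hz
    have h3 : (z : ℚ) * m = N.index := by
      apply mul_left_cancel₀ hW0
      simp only [eq_intCast] at hz
      linear_combination hz
    have h4 : z * (m : ℤ) = (N.index : ℤ) := by exact_mod_cast h3
    exact Int.natCast_dvd_natCast.1 ⟨z, by rw [← h4, mul_comm]⟩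
  refine ⟨⟨m, hm.symm, hmd⟩, fun hpi => ?_⟩
  rw [hm, hp.dvd_mul]
  have : ¬ p ∣ m := fun h => hpi (h.trans hmd)
  tauto
end
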